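/- arXiv:math/0402373 — 3 statements merged into one kernel-verified Lean document; each statement's English description precedes it below -/
import Mathlib

section
/- Let p be a prime with p ≡ 3 (mod 16). Then the equation w² = −2p·x⁴ − p·y⁴ + 2·z⁴ has no solution (w, x, y, z) ∈ ℚ⁴ with (x, y, z) ≠ (0, 0, 0). -/
open NumberTheorySymbols in
theorem jacobiSym_eq_jacobiSym_natAbs {m : ℤ} {p : ℕ} (hm : m % 4 = 1) (hp : p % 4 = 3) :
    J(m | p) = J(p | m.natAbs) := by
  have hpo : Odd p := Nat.odd_iff.mpr (by omega)
  obtain h | h := Int.natAbs_eq m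
  · have h4 : m.natAbs % 4 = 1 := by omega
    conv_lhs => rw [h]
    exact jacobiSym.quadratic_reciprocity_one_mod_four h4 hpo
  · have h4 : m.natAbs % 4 = 3 := by omega
    conv_lhs => rw [h]
    rw [jacobiSym.neg _ hpo, ZMod.χ₄_nat_three_mod_four hp,
      jacobiSym.quadratic_reciprocity_three_mod_four h4 hp]
    ring

theorem Nat.Prime.eq_sq_add_two_mul_sq {p : ℕ} (hp : p.Prime) (hp8 : p % 8 = 3) :
    ∃ a b : ℤ, (p : ℤ) = a ^ 2 + 2 * b ^ 2 := by
  have : Fact p.Prime := ⟨hp⟩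
  obtain ⟨s, hs⟩ : ∃ s : ℤ, (p : ℤ) ∣ s ^ 2 + 2 := by
    obtain ⟨t, ht⟩ := (ZMod.exists_sq_eq_neg_two_iff (p := p) (by omega)).mpr (Or.inr hp8)
    obtain ⟨s, rfl⟩ := ZMod.intCast_surjective t
    refine ⟨s, (ZMod.intCast_zmod_eq_zero_iff_dvd _ p).mp ?_⟩
    push_cast
    rw [sq, ← ht]
    ring
  have hp0 : (0 : ℝ) < p := by exact_mod_cast hp.pos
  have hn : 0 < Nat.sqrt p := Nat.sqrt_pos.mpr hp.pos
  obtain ⟨j, k, hk0, hkn, hjk⟩ := Real.exists_int_int_abs_mul_sub_le ((s : ℝ) / p) hn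
  set r : ℤ := k * s - j * p with hr
  have hn1 : p < (Nat.sqrt p + 1) ^ 2 := by rw [sq]; exact Nat.lt_succ_sqrt p
  have hn2 : Nat.sqrt p ^ 2 ≤ p := Nat.sqrt_le' p
  have hrlt : r ^ 2 < p := by
    have e : (r : ℝ) = (k * ((s : ℝ) / p) - j) * p := by
      rw [hr]; push_cast; field_simp
    have h1 : |(r : ℝ)| * ((Nat.sqrt p : ℝ) + 1) ≤ p := by
      rw [e, abs_mul, abs_of_pos hp0]
      calc _ ≤ 1 / ((Nat.sqrt p : ℝ) + 1) * p * ((Nat.sqrt p : ℝ) + 1) := by gcongr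
        _ = p := by field_simp
    have h2 : |r| * ((Nat.sqrt p : ℤ) + 1) ≤ p := by exact_mod_cast h1
    have hn1' : (p : ℤ) < ((Nat.sqrt p : ℤ) + 1) ^ 2 := by exact_mod_cast hn1
    rw [← sq_abs]
    by_contra! h
    have h3 : |r| < (Nat.sqrt p : ℤ) + 1 := by nlinarith [abs_nonneg r]
    have hpz : (0 : ℤ) < p := by exact_mod_cast hp.pos
    have h4 : 0 < |r| := by
      by_contra! h5
      have : |r| = 0 := le_antisymm h5 (abs_nonneg r)
      rw [this] at h
      linarith
    nlinarith
  have hkle : k ^ 2 ≤ p := by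
    have : (Nat.sqrt p : ℤ) ^ 2 ≤ p := by exact_mod_cast hn2
    nlinarith
  obtain ⟨c, hc⟩ : (p : ℤ) ∣ r ^ 2 + 2 * k ^ 2 := by
    obtain ⟨d, hd⟩ := hs
    refine ⟨k ^ 2 * d - 2 * j * k * s + j ^ 2 * p, ?_⟩
    rw [hr]
    linear_combination k ^ 2 * hd
  have hpz : (0 : ℤ) < p := by exact_mod_cast hp.pos
  have hc0 : 0 < c := by
    have : 0 < (p : ℤ) * c := by rw [← hc]; positivity
    exact pos_of_mul_pos_right this hpz.le
  have hc3 : c < 3 := by nlinarith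
  obtain rfl | rfl : c = 1 ∨ c = 2 := by omega
  · exact ⟨r, k, by linarith⟩
  · have hr2 : (2 : ℤ) ∣ r := Int.prime_two.dvd_of_dvd_pow (n := 2) (by omega)
    obtain ⟨t, ht⟩ := hr2
    refine ⟨k, t, ?_⟩
    rw [ht] at hc
    linarith

open NumberTheorySymbols in
theorem Nat.Prime.eq_sq_add_two_mul_sq_one_mod_four {p : ℕ} (hp : p.Prime) (hmod : p % 16 = 3) :
    ∃ a b : ℤ, (p : ℤ) = a ^ 2 + 2 * b ^ 2 ∧ a % 8 = 1 ∧ b % 4 = 1 ∧ J(-(a * b) | p) = -1 := by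
  have hsign {m : ℤ} (hm : m % 2 = 1) : ∃ m', m' ^ 2 = m ^ 2 ∧ m' % 4 = 1 := by
    obtain h | h : m % 4 = 1 ∨ (-m) % 4 = 1 := by omega
    exacts [⟨m, rfl, h⟩, ⟨-m, by ring, h⟩]
  obtain ⟨a₀, b₀, h₀⟩ := hp.eq_sq_add_two_mul_sq (by omega)
  have hpz : (p : ℤ) % 16 = 3 := by omega
  have ha₀ : a₀ % 2 = 1 := by
    by_contra h
    obtain ⟨t, rfl⟩ : (2 : ℤ) ∣ a₀ := by omega
    have : (p : ℤ) = 2 * (2 * t ^ 2 + b₀ ^ 2) := by rw [h₀]; ring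
    omega
  obtain ⟨a, ha, ha4⟩ := hsign ha₀
  rw [← ha] at h₀
  have hb₀ : b₀ % 2 = 1 := by
    by_contra h
    obtain ⟨t, rfl⟩ : (2 : ℤ) ∣ b₀ := by omega
    obtain ⟨u, hu⟩ : (4 : ℤ) ∣ a - 1 := by omega
    obtain rfl : a = 4 * u + 1 := by omega
    have : (p : ℤ) = 8 * (2 * u ^ 2 + u + t ^ 2) + 1 := by rw [h₀]; ring
    omega
  obtain ⟨b, hb, hb4⟩ := hsign hb₀
  rw [← hb] at h₀
  have ha8 : a % 8 = 1 := by
    by_contra h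
    obtain ⟨u, rfl⟩ : ∃ u, a = 8 * u + 5 := ⟨a / 8, by omega⟩
    obtain ⟨v, rfl⟩ : ∃ v, b = 4 * v + 1 := ⟨b / 4, by omega⟩
    have : (p : ℤ) = 16 * (4 * u ^ 2 + 5 * u + 2 * v ^ 2 + v + 1) + 11 := by rw [h₀]; ring
    omega
  refine ⟨a, b, h₀, ha8, hb4, ?_⟩
  have hcop : IsCoprime a b := by
    rw [Int.isCoprime_iff_gcd_eq_one]
    by_contra hg
    obtain ⟨q, hq, hqg⟩ := Nat.exists_prime_and_dvd hg
    have hqa : (q : ℤ) ∣ a := (Int.natCast_dvd_natCast.mpr hqg).trans (Int.gcd_dvd_left ..)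
    have hqb : (q : ℤ) ∣ b := (Int.natCast_dvd_natCast.mpr hqg).trans (Int.gcd_dvd_right ..)
    have hqp : (q : ℤ) ^ 2 ∣ p := by
      rw [h₀]
      exact dvd_add (pow_dvd_pow_of_dvd hqa 2) ((pow_dvd_pow_of_dvd hqb 2).mul_left 2)
    have hqp' : q ^ 2 ∣ p := by exact_mod_cast hqp
    exact Nat.squarefree_iff_prime_squarefree.mp hp.squarefree q hq (by rwa [← sq])
  have hJb : J(b | p) = 1 := by
    rw [jacobiSym_eq_jacobiSym_natAbs hb4 (by omega),
      jacobiSym.mod_left' (a₂ := a ^ 2), jacobiSym.sq_one']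
    · simpa [Int.gcd, Int.natAbs_abs] using Int.isCoprime_iff_gcd_eq_one.mp hcop
    · exact Int.modEq_iff_dvd.mpr (Int.natAbs_dvd.mpr ⟨-2 * b, by rw [h₀]; ring⟩)
  have hJa : J(a | p) = 1 := by
    have hao : Odd a.natAbs := Nat.odd_iff.mpr (by omega)
    rw [jacobiSym_eq_jacobiSym_natAbs ha4 (by omega),
      jacobiSym.mod_left' (a₂ := 2 * b ^ 2), jacobiSym.mul_left, jacobiSym.sq_one',
      jacobiSym.at_two hao, ZMod.χ₈_nat_eq_if_mod_eight, if_neg (by omega), if_pos (by omega)]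
    · rfl
    · simpa [Int.gcd, Int.natAbs_abs] using Int.isCoprime_iff_gcd_eq_one.mp hcop.symm
    · exact Int.modEq_iff_dvd.mpr (Int.natAbs_dvd.mpr ⟨-a, by rw [h₀]; ring⟩)
  rw [jacobiSym.neg _ (Nat.odd_iff.mpr (by omega)), jacobiSym.mul_left, hJa, hJb,
    ZMod.χ₄_nat_three_mod_four (by omega)]
  rfl

theorem dvd_and_dvd_of_dvd_sq_add_sq {q : ℕ} (hq : q.Prime) (hq4 : q % 4 = 3) {x y : ℤ}
    (h : (q : ℤ) ∣ x ^ 2 + y ^ 2) : (q : ℤ) ∣ x ∧ (q : ℤ) ∣ y := by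
  have : Fact q.Prime := ⟨hq⟩
  refine jacobiSym.prime_dvd_of_eq_neg_one (a := -1) ?_ (by simpa using h)
  rw [jacobiSym.at_neg_one (Nat.odd_iff.mpr (by omega)), ZMod.χ₄_nat_three_mod_four hq4]

theorem Nat.mod_four_ne_three_of_two_mul_mul_eq_sq_add_sq {F G w v : ℕ} (hF : F ≠ 0) (hG : G ≠ 0)
    (h : 2 * (F * G) = w ^ 2 + v ^ 2)
    (hcop : ∀ q : ℕ, q.Prime → q % 4 = 3 → q ∣ F → ¬ q ∣ G) : F % 4 ≠ 3 := by
  obtain ⟨s, t, hst⟩ := (Nat.eq_sq_add_sq_iff (n := F)).mpr fun q hqF hq4 ↦ by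
    have hq := Nat.prime_of_mem_primeFactors hqF
    have hqd := Nat.dvd_of_mem_primeFactors hqF
    have : Fact q.Prime := ⟨hq⟩
    have heven := Nat.eq_sq_add_sq_iff.mp ⟨w, v, h⟩ q (Nat.mem_primeFactors.mpr
      ⟨hq, (hqd.mul_right G).mul_left 2, by positivity⟩) hq4
    have hq2 : ¬ q ∣ 2 := fun hd ↦ by
      have := (Nat.prime_dvd_prime_iff_eq hq Nat.prime_two).mp hd
      omega
    rwa [padicValNat.mul two_ne_zero (by positivity), padicValNat.mul hF hG,
      padicValNat.eq_zero_of_not_dvd hq2, padicValNat.eq_zero_of_not_dvd (hcop q hq hq4 hqd),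
      zero_add, add_zero] at heven
  have key : ∀ s t : ZMod 4, s ^ 2 + t ^ 2 ≠ 3 := by decide
  intro h3
  apply key s t
  have : ((F : ℕ) : ZMod 4) = (3 : ℕ) := (ZMod.natCast_eq_natCast_iff' _ _ _).mpr h3
  rw [hst] at this
  exact_mod_cast this

theorem Int.odd_of_sq_eq_neg_two_mul_pow_four {p w x y z : ℤ} (hmod : p % 16 = 3)
    (h : w ^ 2 = -2 * p * x ^ 4 - p * y ^ 4 + 2 * z ^ 4)
    (h2 : ¬ (2 ∣ x ∧ 2 ∣ y ∧ 2 ∣ z)) : x % 2 = 1 ∧ y % 2 = 1 ∧ z % 2 = 1 := by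
  have hpow (t : ℤ) : t % 2 = 0 ∧ t ^ 4 % 16 = 0 ∨ t % 2 = 1 ∧ t ^ 4 % 16 = 1 := by
    obtain ⟨s, rfl | rfl⟩ := Int.even_or_odd' t
    · have : (2 * s) ^ 4 = 16 * s ^ 4 := by ring
      omega
    · obtain ⟨r, hr⟩ := Int.even_mul_succ_self s
      have : (2 * s + 1) ^ 4 = 16 * (s ^ 4 + 2 * s ^ 3 + s ^ 2 + r) + 1 := by
        linear_combination 8 * hr
      omega
  have hw : w ^ 2 % 8 = 1 ∨ w ^ 2 % 16 = 0 ∨ w ^ 2 % 16 = 4 := by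
    obtain ⟨s, rfl | rfl⟩ := Int.even_or_odd' w
    · obtain ⟨m, rfl | rfl⟩ := Int.even_or_odd' s
      · have : (2 * (2 * m)) ^ 2 = 16 * m ^ 2 := by ring
        omega
      · have : (2 * (2 * m + 1)) ^ 2 = 16 * (m ^ 2 + m) + 4 := by ring
        omega
    · obtain ⟨r, hr⟩ := Int.even_mul_succ_self s
      have : (2 * s + 1) ^ 2 = 8 * r + 1 := by linear_combination 4 * hr
      omega
  obtain ⟨k, rfl⟩ : ∃ k, p = 16 * k + 3 := ⟨p / 16, by omega⟩
  have h' : w ^ 2 = -32 * (k * x ^ 4) - 6 * x ^ 4 - 16 * (k * y ^ 4) - 3 * y ^ 4 + 2 * z ^ 4 := by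
    rw [h]; ring
  clear h
  obtain ⟨hx0, hx4⟩ | ⟨hx0, hx4⟩ := hpow x <;>
  obtain ⟨hy0, hy4⟩ | ⟨hy0, hy4⟩ := hpow y <;>
  obtain ⟨hz0, hz4⟩ | ⟨hz0, hz4⟩ := hpow z <;>
  omega

/-- A primitive solution gives `2 * F * G = w ^ 2 + (2 * b * x ^ 2 - a * y ^ 2) ^ 2`, where
`F, G = z ^ 2 ∓ (a * x ^ 2 + b * y ^ 2)` and `p = a ^ 2 + 2 * b ^ 2`. Here `F` and `G` have no
common prime factor congruent to `3` modulo `4`, which is incompatible with `F % 4 = 3`. -/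
theorem delPezzo_two_p_no_primitive_solution {p : ℕ} (hp : p.Prime) (hmod : p % 16 = 3) {w x y z : ℤ}
    (h : w ^ 2 = -2 * p * x ^ 4 - p * y ^ 4 + 2 * z ^ 4)
    (hprim : ∀ q : ℕ, q.Prime → ¬ ((q : ℤ) ∣ x ∧ (q : ℤ) ∣ y ∧ (q : ℤ) ∣ z)) : False := by
  have : Fact p.Prime := ⟨hp⟩
  have hpp : Prime (p : ℤ) := Nat.prime_iff_prime_int.mp hp
  obtain ⟨a, b, hab, ha8, hb4, hJ⟩ := hp.eq_sq_add_two_mul_sq_one_mod_four hmod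
  obtain ⟨hx, hy, hz⟩ := Int.odd_of_sq_eq_neg_two_mul_pow_four (by omega) h
    (by exact_mod_cast hprim 2 Nat.prime_two)
  set F := z ^ 2 - (a * x ^ 2 + b * y ^ 2) with hF
  set G := z ^ 2 + (a * x ^ 2 + b * y ^ 2) with hG
  have hFG : 2 * (F * G) = w ^ 2 + (2 * b * x ^ 2 - a * y ^ 2) ^ 2 := by
    rw [h, hab, hF, hG]; ring
  have hsq {t : ℤ} (ht : t % 2 = 1) : t ^ 2 % 4 = 1 := by
    rw [sq, Int.mul_emod]
    obtain h | h : t % 4 = 1 ∨ t % 4 = 3 := by omega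
    all_goals rw [h]; rfl
  have hx4 := hsq hx
  have hy4 := hsq hy
  have hz4 := hsq hz
  have hax : a * x ^ 2 % 4 = 1 := by
    rw [Int.mul_emod, hx4, show a % 4 = 1 by omega]; rfl
  have hby : b * y ^ 2 % 4 = 1 := by
    rw [Int.mul_emod, hy4, hb4]; rfl
  have hF4 : F % 4 = 3 := by omega
  have hG4 : G % 4 = 3 := by omega
  have hnonneg : 0 ≤ F * G := by nlinarith [sq_nonneg w, sq_nonneg (2 * b * x ^ 2 - a * y ^ 2)]
  have hadd : 0 ≤ F + G := by rw [hF, hG]; nlinarith [sq_nonneg z]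
  have hFpos : 0 < F := by
    by_contra! hn
    have hF' : F < 0 := by omega
    nlinarith [show 0 < G by omega]
  have hGpos : 0 < G := by
    by_contra! hn
    have hG' : G < 0 := by omega
    nlinarith
  refine Nat.mod_four_ne_three_of_two_mul_mul_eq_sq_add_sq (F := F.natAbs) (G := G.natAbs)
    (w := w.natAbs) (v := (2 * b * x ^ 2 - a * y ^ 2).natAbs) (by omega) (by omega) ?_ ?_ (by omega)
  · zify
    rwa [sq_abs, sq_abs, abs_of_pos hFpos, abs_of_pos hGpos]
  · intro q hq hq4 hqF hqG
    have hqp : Prime (q : ℤ) := Nat.prime_iff_prime_int.mp hq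
    rw [← Int.natCast_dvd] at hqF hqG
    have hq2 : ¬ (q : ℤ) ∣ 2 := fun hd ↦ by
      have := Int.le_of_dvd (by norm_num) hd
      have := hq.two_le
      omega
    have hqz : (q : ℤ) ∣ z := by
      have : (q : ℤ) ∣ 2 * z ^ 2 := by
        have := dvd_add hqF hqG
        rwa [hF, hG, show ∀ s t : ℤ, s - t + (s + t) = 2 * s by intros; ring] at this
      exact hqp.dvd_of_dvd_pow ((hqp.dvd_or_dvd this).resolve_left hq2)
    have hqu : (q : ℤ) ∣ a * x ^ 2 + b * y ^ 2 :=
      (Int.dvd_add_right (dvd_pow hqz two_ne_zero)).mp hqG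
    have hqv : (q : ℤ) ∣ 2 * b * x ^ 2 - a * y ^ 2 :=
      (dvd_and_dvd_of_dvd_sq_add_sq hq hq4 (hFG ▸ (hqF.mul_right G).mul_left 2)).2
    apply hprim q hq
    by_cases hqp' : q = p
    · subst hqp'
      have hdvd : (q : ℤ) ∣ (a * x) ^ 2 - (-(a * b)) * y ^ 2 := by
        have := hqu.mul_left a
        rwa [show a * (a * x ^ 2 + b * y ^ 2) = (a * x) ^ 2 - (-(a * b)) * y ^ 2 by ring] at this
      obtain ⟨hqax, hqy⟩ := jacobiSym.prime_dvd_of_eq_neg_one hJ hdvd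
      refine ⟨(hqp.dvd_or_dvd hqax).resolve_left fun hqa ↦ ?_, hqy, hqz⟩
      have : (q : ℤ) ∣ -(a * b) := ((hqa.mul_right b)).neg_right
      rw [jacobiSym.mod_left, Int.emod_eq_zero_of_dvd this, jacobiSym.zero_left hq.one_lt] at hJ
      norm_num at hJ
    · have hqp2 : ¬ (q : ℤ) ∣ p := fun hd ↦
        hqp' ((Nat.prime_dvd_prime_iff_eq hq hp).mp (by exact_mod_cast hd))
      have hx' : (q : ℤ) ∣ p * x ^ 2 := by
        rw [hab, show (a ^ 2 + 2 * b ^ 2) * x ^ 2 =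
          a * (a * x ^ 2 + b * y ^ 2) + b * (2 * b * x ^ 2 - a * y ^ 2) by ring]
        exact dvd_add (hqu.mul_left a) (hqv.mul_left b)
      have hy' : (q : ℤ) ∣ p * y ^ 2 := by
        rw [hab, show (a ^ 2 + 2 * b ^ 2) * y ^ 2 =
          2 * b * (a * x ^ 2 + b * y ^ 2) - a * (2 * b * x ^ 2 - a * y ^ 2) by ring]
        exact dvd_sub (hqu.mul_left _) (hqv.mul_left a)
      exact ⟨hqp.dvd_of_dvd_pow ((hqp.dvd_or_dvd hx').resolve_left hqp2),
        hqp.dvd_of_dvd_pow ((hqp.dvd_or_dvd hy').resolve_left hqp2), hqz⟩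

theorem exists_primitive_int_mul {x y z : ℚ} (hne : (x, y, z) ≠ (0, 0, 0)) :
    ∃ (c : ℚ) (X Y Z : ℤ), c * x = X ∧ c * y = Y ∧ c * z = Z ∧
      ∀ q : ℕ, q.Prime → ¬ ((q : ℤ) ∣ X ∧ (q : ℤ) ∣ Y ∧ (q : ℤ) ∣ Z) := by
  set d : ℚ := x.den * y.den * z.den with hd
  have hd0 : d ≠ 0 := by simp [hd]
  set X₀ : ℤ := x.num * y.den * z.den with hX₀
  set Y₀ : ℤ := y.num * x.den * z.den with hY₀
  set Z₀ : ℤ := z.num * x.den * y.den with hZ₀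
  have hX : d * x = X₀ := by
    rw [hd, hX₀]; push_cast; linear_combination (y.den : ℚ) * z.den * x.den_mul_eq_num
  have hY : d * y = Y₀ := by
    rw [hd, hY₀]; push_cast; linear_combination (x.den : ℚ) * z.den * y.den_mul_eq_num
  have hZ : d * z = Z₀ := by
    rw [hd, hZ₀]; push_cast; linear_combination (x.den : ℚ) * y.den * z.den_mul_eq_num
  set g : ℤ := gcd X₀ (gcd Y₀ Z₀) with hg
  have hg0 : g ≠ 0 := fun h0 ↦ hne <| by
    rw [hg, gcd_eq_zero_iff, gcd_eq_zero_iff] at h0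
    obtain ⟨h1, h2, h3⟩ := h0
    have hx : x = 0 := by simpa [h1, hd0] using hX
    have hy : y = 0 := by simpa [h2, hd0] using hY
    have hz : z = 0 := by simpa [h3, hd0] using hZ
    rw [hx, hy, hz]
  have hgq : (g : ℚ) ≠ 0 := by exact_mod_cast hg0
  obtain ⟨X, hX'⟩ : g ∣ X₀ := gcd_dvd_left _ _
  obtain ⟨Y, hY'⟩ : g ∣ Y₀ := (gcd_dvd_right _ _).trans (gcd_dvd_left _ _)
  obtain ⟨Z, hZ'⟩ : g ∣ Z₀ := (gcd_dvd_right _ _).trans (gcd_dvd_right _ _)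
  have hdiv {u : ℚ} {U₀ U : ℤ} (h : d * u = U₀) (h' : U₀ = g * U) : d / g * u = U := by
    rw [h'] at h
    push_cast at h
    field_simp
    exact h
  refine ⟨d / g, X, Y, Z, hdiv hX hX', hdiv hY hY', hdiv hZ hZ', fun q hq ⟨h1, h2, h3⟩ ↦ ?_⟩
  have hgg : g * q ∣ g * 1 := by
    rw [mul_one]
    refine dvd_gcd ?_ (dvd_gcd ?_ ?_)
    · rw [hX']; exact mul_dvd_mul_left g h1
    · rw [hY']; exact mul_dvd_mul_left g h2
    · rw [hZ']; exact mul_dvd_mul_left g h3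
  exact (Nat.prime_iff_prime_int.mp hq).not_isUnit
    (isUnit_of_dvd_one ((mul_dvd_mul_iff_left hg0).mp hgg))

/-- For a prime `p ≡ 3 (mod 16)`, the equation `w² = −2p·x⁴ − p·y⁴ + 2·z⁴` has no
rational solution with `(x, y, z) ≠ (0, 0, 0)`. -/
theorem delPezzo_two_p_no_rational_points (p : ℕ) (hp : p.Prime) (hmod : p % 16 = 3) :
    ¬ ∃ w x y z : ℚ, w ^ 2 = -2 * p * x ^ 4 - p * y ^ 4 + 2 * z ^ 4 ∧
      (x, y, z) ≠ (0, 0, 0) := by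
  rintro ⟨w, x, y, z, h, hne⟩
  obtain ⟨c, X, Y, Z, hX, hY, hZ, hprim⟩ := exists_primitive_int_mul hne
  have hW : (c ^ 2 * w) ^ 2 = ((-2 * p * X ^ 4 - p * Y ^ 4 + 2 * Z ^ 4 : ℤ) : ℚ) := by
    push_cast
    rw [← hX, ← hY, ← hZ]
    linear_combination c ^ 4 * h
  have hden : (c ^ 2 * w).den = 1 := by
    have := congrArg Rat.den hW
    rwa [Rat.den_pow, Rat.den_intCast, Nat.pow_eq_one, or_iff_left two_ne_zero] at this
  rw [← Rat.coe_int_num_of_den_eq_one hden] at hW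
  exact delPezzo_two_p_no_primitive_solution hp hmod (by exact_mod_cast hW) hprim
end

section
/- Let p be a prime with p ≡ 3 (mod 16), and write p = u² + 2v² for positive integers u and v. If y is an integer with y⁴ ≡ −2 (mod p), then v·y² ≡ (−1)^((u−v)/2)·u (mod p). -/
open NumberTheorySymbols ZMod in
/-- Reciprocity for a prime modulus `p ≡ 3 (mod 4)`, in terms of the character `χ₄`. -/
theorem jacobiSym_eq_chi_four_mul {a p : ℕ} (ha : Odd a) (hp : p % 4 = 3) :
    J(a | p) = χ₄ a * J(p | a) := by
  have hpo : Odd p := Nat.odd_iff.mpr (by omega)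
  rw [jacobiSym.quadratic_reciprocity' ha hpo, qrSign, χ₄_nat_three_mod_four hp,
    jacobiSym.at_neg_one ha]

open NumberTheorySymbols ZMod in
/-- If `p = u² + 2v²` with `v` odd and prime to `u`, then `(v/p) = χ₄(v)`. -/
theorem jacobiSym_of_eq_sq_add_two_mul_sq_right {p u v : ℕ} (hp : p % 4 = 3)
    (h : p = u ^ 2 + 2 * v ^ 2) (hv : Odd v) (huv : u.Coprime v) :
    J(v | p) = χ₄ v := by
  have hmod : J(p | v) = J((u : ℤ) ^ 2 | v) := by
    apply jacobiSym.mod_left'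
    rw [h]
    push_cast
    rw [show (u : ℤ) ^ 2 + 2 * v ^ 2 = u ^ 2 + v * (2 * v) by ring, Int.add_mul_emod_self_left]
  rw [jacobiSym_eq_chi_four_mul hv hp, hmod, jacobiSym.sq_one' (by simpa using huv), mul_one]

open NumberTheorySymbols ZMod in
/-- If `p = u² + 2v²` with `u ≡ ±1 (mod 8)` prime to `v`, then `(u/p) = χ₄(u)`. -/
theorem jacobiSym_of_eq_sq_add_two_mul_sq_left {p u v : ℕ} (hp : p % 4 = 3)
    (h : p = u ^ 2 + 2 * v ^ 2) (hu : u % 8 = 1 ∨ u % 8 = 7) (huv : u.Coprime v) :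
    J(u | p) = χ₄ u := by
  have hodd : Odd u := Nat.odd_iff.mpr (by omega)
  have hmod : J(p | u) = J(2 * (v : ℤ) ^ 2 | u) := by
    apply jacobiSym.mod_left'
    rw [h]
    push_cast
    rw [show (u : ℤ) ^ 2 + 2 * v ^ 2 = 2 * v ^ 2 + u * u by ring, Int.add_mul_emod_self_left]
  have htwo : J(2 | u) = 1 := by
    rw [jacobiSym.at_two hodd, χ₈_nat_eq_if_mod_eight]
    rcases hu with hu | hu <;> simp [hu] <;> omega
  rw [jacobiSym_eq_chi_four_mul hodd hp, hmod, jacobiSym.mul_left, htwo,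
    jacobiSym.sq_one' (by simpa using huv.symm), mul_one, mul_one]

/-- In `p = u² + 2v²` with `p ≡ 3 (mod 16)`, `v` is odd and `u ≡ ±1 (mod 8)`. -/
theorem mod_eight_of_eq_sq_add_two_mul_sq {p u v : ℕ} (hp : p % 16 = 3)
    (h : p = u ^ 2 + 2 * v ^ 2) : Odd v ∧ (u % 8 = 1 ∨ u % 8 = 7) := by
  have key : ∀ a < 16, ∀ b < 16, (a ^ 2 + 2 * b ^ 2) % 16 = 3 →
      b % 2 = 1 ∧ (a % 8 = 1 ∨ a % 8 = 7) := by decide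
  have := key (u % 16) (Nat.mod_lt _ (by norm_num)) (v % 16) (Nat.mod_lt _ (by norm_num))
    (by rw [← hp, h]; simp [Nat.add_mod, Nat.mul_mod, Nat.pow_mod])
  rw [Nat.odd_iff]
  omega

theorem Nat.Prime.coprime_of_eq_sq_add_two_mul_sq {p u v : ℕ} (hp : p.Prime)
    (h : p = u ^ 2 + 2 * v ^ 2) : u.Coprime v := by
  have hdvd : u.gcd v * u.gcd v ∣ p := by
    rw [h, ← sq]
    exact dvd_add (pow_dvd_pow_of_dvd (Nat.gcd_dvd_left u v) 2)
      ((pow_dvd_pow_of_dvd (Nat.gcd_dvd_right u v) 2).mul_left 2)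
  exact Nat.isUnit_iff.mp (hp.prime.irreducible.squarefree _ hdvd)

open NumberTheorySymbols ZMod in
/-- Lemma 7.2: for a prime `p ≡ 3 (mod 16)` with `p = u² + 2v²` (`u, v > 0`), if
`y⁴ ≡ −2 (mod p)` then `v·y² ≡ (−1)^((u−v)/2)·u (mod p)`. -/
theorem lemma_quartic_root_congruence (p : ℕ) (hp : p.Prime) (hmod : p % 16 = 3)
    (u v : ℤ) (hu : 0 < u) (hv : 0 < v) (hp2 : (p : ℤ) = u ^ 2 + 2 * v ^ 2)
    (y : ℤ) (hy : y ^ 4 ≡ -2 [ZMOD (p : ℤ)]) :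
    v * y ^ 2 ≡ (-1) ^ ((u - v) / 2).natAbs * u [ZMOD (p : ℤ)] := by
  lift u to ℕ using hu.le
  lift v to ℕ using hv.le
  have h : p = u ^ 2 + 2 * v ^ 2 := by exact_mod_cast hp2
  have hpi : Prime (p : ℤ) := Nat.prime_iff_prime_int.mp hp
  have huv := hp.coprime_of_eq_sq_add_two_mul_sq h
  obtain ⟨hvo, hu8⟩ := mod_eight_of_eq_sq_add_two_mul_sq hmod h
  have hvp := jacobiSym_of_eq_sq_add_two_mul_sq_right (by omega) h hvo huv
  have hup := jacobiSym_of_eq_sq_add_two_mul_sq_left (by omega) h hu8 huv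
  have hpo : Odd p := Nat.odd_iff.mpr (by omega)
  have hy_coprime : y.gcd p = 1 := by
    rw [Int.gcd_comm, ← Int.isCoprime_iff_gcd_eq_one, hpi.coprime_iff_not_dvd]
    intro hdvd
    have h2 : (p : ℤ) ∣ 2 := by
      have := (hdvd.trans (dvd_pow_self y four_ne_zero)).add (hy.dvd)
      rw [← dvd_neg]
      simpa using this
    have := Nat.le_of_dvd two_pos (by exact_mod_cast h2 : p ∣ 2)
    omega
  have hsym : J(v * y ^ 2 | p) = χ₄ v := by
    rw [jacobiSym.mul_left, jacobiSym.sq_one' hy_coprime, mul_one, hvp]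
  have hfactor : (p : ℤ) ∣ (v * y ^ 2 - u) * (v * y ^ 2 + u) := by
    have h1 : (p : ℤ) ∣ y ^ 4 + 2 := by simpa using hy.symm.dvd
    have h2 : ((v : ℤ) * y ^ 2 - u) * (v * y ^ 2 + u) = v ^ 2 * (y ^ 4 + 2) - p := by
      rw [hp2]; ring
    rw [h2]
    exact (h1.mul_left _).sub dvd_rfl
  have hu4 : u % 4 = 1 ∨ u % 4 = 3 := by omega
  have hv4 : v % 4 = 1 ∨ v % 4 = 3 := by have := Nat.odd_iff.mp hvo; omega
  rcases hpi.dvd_or_dvd hfactor with hd | hd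
  · have hcong : (v : ℤ) * y ^ 2 ≡ u [ZMOD p] := (Int.modEq_iff_dvd.mpr hd).symm
    have hchi : χ₄ (v : ZMod 4) = χ₄ (u : ZMod 4) := by
      rw [← hsym, ← hup, jacobiSym.mod_left' hcong]
    have heven : Even ((u - v : ℤ) / 2).natAbs := by
      rw [Int.natAbs_even, Int.even_iff]
      rcases hu4 with h1 | h1 <;> rcases hv4 with h2 | h2 <;>
        first
          | omega
          | (rw [χ₄_nat_mod_four, h2, χ₄_nat_mod_four u, h1] at hchi
             exact absurd hchi (by decide))
    rwa [heven.neg_one_pow, one_mul]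
  · have hcong : (v : ℤ) * y ^ 2 ≡ -u [ZMOD p] :=
      (Int.modEq_iff_dvd.mpr (by simpa using hd)).symm
    have hchi : χ₄ (v : ZMod 4) = -χ₄ (u : ZMod 4) := by
      rw [← hsym, ← hup, jacobiSym.mod_left' hcong, jacobiSym.neg _ hpo,
        χ₄_nat_three_mod_four (by omega), neg_one_mul]
    have hodd : Odd ((u - v : ℤ) / 2).natAbs := by
      rw [Int.natAbs_odd, Int.odd_iff]
      rcases hu4 with h1 | h1 <;> rcases hv4 with h2 | h2 <;>
        first
          | omega
          | (rw [χ₄_nat_mod_four, h2, χ₄_nat_mod_four u, h1] at hchi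
             exact absurd hchi (by decide))
    rwa [hodd.neg_one_pow, neg_one_mul]
end

section
/- The equation w² = −9826·x⁴ − 2·y⁴ + 136·z⁴ has no solution (w, x, y, z) ∈ ℚ⁴ with (x, y, z) ≠ (0, 0, 0). -/
open scoped NumberTheorySymbols

/-- If `r` is not a square modulo the prime `ϖ`, then `s ^ 2 - r * t ^ 2` has even valuation. -/
theorem even_of_pow_mul_eq_norm {R : Type*} [CommRing R] [IsDomain R] {ϖ r k : R}
    (hϖ : Prime ϖ) (hk : ¬ϖ ∣ k) (hr : ∀ s t, ϖ ∣ s ^ 2 - r * t ^ 2 → ϖ ∣ s ∧ ϖ ∣ t)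
    (m : ℕ) : ∀ {W s t : R}, ¬ϖ ∣ W → ϖ ^ m * W = k * (s ^ 2 - r * t ^ 2) → Even m := by
  induction m using Nat.strong_induction_on with
  | _ m ih =>
    intro W s t hW h
    obtain rfl | hm := Nat.eq_zero_or_pos m
    · exact Even.zero
    have hd : ϖ ∣ k * (s ^ 2 - r * t ^ 2) :=
      h ▸ Dvd.dvd.mul_right (dvd_pow_self ϖ hm.ne') W
    obtain ⟨⟨s, rfl⟩, ⟨t, rfl⟩⟩ := hr s t ((hϖ.dvd_or_dvd hd).resolve_left hk)
    obtain _ | _ | m := m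
    · omega
    · have : W = ϖ * (k * (s ^ 2 - r * t ^ 2)) :=
        mul_left_cancel₀ hϖ.ne_zero (by linear_combination h)
      exact absurd ⟨_, this⟩ hW
    · have : ϖ ^ m * W = k * (s ^ 2 - r * t ^ 2) :=
        mul_left_cancel₀ (pow_ne_zero 2 hϖ.ne_zero) (by linear_combination h)
      exact (ih m (by omega) hW this).add even_two

theorem dvd_of_dvd_sq_sub_of_not_isSquare {R F : Type*} [CommRing R] [Field F] (ε : R →+* F)
    {ϖ r : R} (hε : ∀ s, ϖ ∣ s ↔ ε s = 0) (hr : ¬IsSquare (ε r)) (s t : R)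
    (h : ϖ ∣ s ^ 2 - r * t ^ 2) : ϖ ∣ s ∧ ϖ ∣ t := by
  simp only [hε, map_sub, map_mul, map_pow] at h ⊢
  have ht : ε t = 0 := by
    by_contra ht
    exact hr ⟨ε s / ε t, by field_simp; linear_combination -h⟩
  refine ⟨?_, ht⟩
  simpa [ht] using h

theorem jacobiSym_eq_prod (D : ℤ) {M : ℕ} (hM : M ≠ 0) {s : Finset ℕ} (hs : M.primeFactors ⊆ s) :
    J(D | M) = ∏ l ∈ s, J(D | l) ^ M.factorization l := by
  have key : ∀ M : ℕ, M ≠ 0 → J(D | M) = M.factorization.prod fun l k => J(D | l) ^ k := by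
    intro M hM
    rw [Nat.multiplicative_factorization' (fun n => J(D | n)) _ (by simp) (by simp)]
    · exact Finsupp.prod_congr fun l _ => jacobiSym.pow_right _ _ _
    · intro m n hmn
      by_cases hm : m = 0
      · subst hm; simp_all
      by_cases hn : n = 0
      · subst hn; simp_all
      exact jacobiSym.mul_right' D hm hn
  rw [key M hM, Finsupp.prod_of_support_subset _ hs _ (by simp)]

/-- A product of two Jacobi symbols is `1` as soon as all its local contributions are. -/
theorem jacobiSym_mul_jacobiSym_eq_one {D E : ℤ} {M g : ℕ} (hM : M ≠ 0) (hg : g ≠ 0)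
    (h : ∀ l i j M' g' : ℕ, l.Prime → (l ∣ M ∨ l ∣ g) → M = l ^ j * M' → ¬l ∣ M' →
      g = l ^ i * g' → ¬l ∣ g' → J(D | l) ^ j * J(E | l) ^ i = 1) :
    J(D | M) * J(E | g) = 1 := by
  rw [jacobiSym_eq_prod D hM (Nat.primeFactors_mono (Dvd.intro g rfl) (mul_ne_zero hM hg)),
    jacobiSym_eq_prod E hg (Nat.primeFactors_mono (Dvd.intro_left M rfl) (mul_ne_zero hM hg)),
    ← Finset.prod_mul_distrib]
  refine Finset.prod_eq_one fun l hl => ?_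
  have hl' := Nat.prime_of_mem_primeFactors hl
  exact h l _ _ _ _ hl' (hl'.dvd_mul.1 (Nat.dvd_of_mem_primeFactors hl))
    (Nat.ordProj_mul_ordCompl_eq_self M l).symm (Nat.not_dvd_ordCompl hl' hM)
    (Nat.ordProj_mul_ordCompl_eq_self g l).symm (Nat.not_dvd_ordCompl hl' hg)

theorem jacobiSym_eq_one_of_local {D : ℤ} {M : ℕ} (hM : M ≠ 0)
    (h : ∀ l j M' : ℕ, l.Prime → l ∣ M → M = l ^ j * M' → ¬l ∣ M' → J(D | l) ^ j = 1) :
    J(D | M) = 1 := by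
  have := jacobiSym_mul_jacobiSym_eq_one (D := D) (E := 1) hM one_ne_zero
    fun l i j M' g' hl hd hj hM' _ _ => by
      rw [jacobiSym.one_left, one_pow, mul_one]
      exact h l j M' hl (hd.resolve_right fun h => hl.one_lt.ne' (Nat.dvd_one.1 h)) hj hM'
  simpa using this

/-- `17` is a square in `ℤ_[l]` as soon as it is one modulo `l`. -/
theorem exists_padicInt_sq_eq_of_isSquare {l : ℕ} [Fact l.Prime] (hl2 : l ≠ 2) (hl17 : l ≠ 17)
    (h : IsSquare (17 : ZMod l)) : ∃ ρ : ℤ_[l], ρ ^ 2 = 17 := by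
  obtain ⟨s, hs⟩ := h
  obtain ⟨a, rfl⟩ := ZMod.intCast_surjective s
  have hl : l.Prime := Fact.out
  have ha : (l : ℤ) ∣ a ^ 2 - 17 := by
    rw [← ZMod.intCast_zmod_eq_zero_iff_dvd]
    push_cast
    rw [hs]; ring
  have ha' : ¬(l : ℤ) ∣ 2 * a := by
    intro h
    have hp := Nat.prime_iff_prime_int.1 hl
    rcases hp.dvd_or_dvd h with h | h
    · exact hl2 ((Nat.prime_dvd_prime_iff_eq hl Nat.prime_two).1 (by exact_mod_cast h))
    · have : (l : ℤ) ∣ 17 := by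
        have := (h.mul_right a).sub ha
        ring_nf at this
        exact this
      exact hl17 ((Nat.prime_dvd_prime_iff_eq hl (by norm_num)).1 (by exact_mod_cast this))
  have h1 : ‖((a ^ 2 - 17 : ℤ) : ℤ_[l])‖ < 1 := PadicInt.norm_int_lt_one_iff_dvd _ |>.2 ha
  have h2 : ‖((2 * a : ℤ) : ℤ_[l])‖ = 1 := by
    refine le_antisymm (PadicInt.norm_le_one _) (not_lt.1 fun h => ha' ?_)
    exact PadicInt.norm_int_lt_one_iff_dvd _ |>.1 h
  obtain ⟨ρ, hρ, -⟩ := hensels_lemma (p := l) (R := ℤ_[l])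
    (F := (Polynomial.X ^ 2 - Polynomial.C 17 : Polynomial ℤ_[l])) (a := (a : ℤ_[l])) (by
      have e : Polynomial.aeval (a : ℤ_[l])
          (Polynomial.X ^ 2 - Polynomial.C 17 : Polynomial ℤ_[l]).derivative =
            ((2 * a : ℤ) : ℤ_[l]) := by
        simp [one_add_one_eq_two]
      rw [e, h2]
      simpa using h1)
  exact ⟨ρ, by simpa [sub_eq_zero] using hρ⟩

/-- A binary Hermitian form over `ℤ[√-2]` which is degenerate, positive and primitive is the square
of a linear form; here the form is `[[m, α], [ᾱ, n]]` with `α = s + t√-2`. -/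
theorem exists_factorization (N : ℕ) : ∀ {m n s t : ℤ}, 0 ≤ m → 0 ≤ n → m + n ≤ N →
    s ^ 2 + 2 * t ^ 2 = m * n → (∀ p, p ∣ m → p ∣ n → p ∣ s → p ∣ t → IsUnit p) →
    ∃ a b c d : ℤ, a ^ 2 + 2 * b ^ 2 = m ∧ c ^ 2 + 2 * d ^ 2 = n ∧
      a * c - 2 * b * d = s ∧ a * d + b * c = t := by
  induction N with
  | zero =>
    intro m n s t hm hn hN _ hu
    obtain rfl : m = 0 := by push_cast at hN; omega
    obtain rfl : n = 0 := by push_cast at hN; omega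
    obtain rfl : s = 0 := by nlinarith
    obtain rfl : t = 0 := by nlinarith
    have := hu 0 (by simp) (by simp) (by simp) (by simp)
    simp at this
  | succ N ih =>
    have key : ∀ {m n s t : ℤ}, 0 ≤ m → m ≤ n → m + n ≤ (N + 1 : ℕ) →
        s ^ 2 + 2 * t ^ 2 = m * n → (∀ p, p ∣ m → p ∣ n → p ∣ s → p ∣ t → IsUnit p) →
        ∃ a b c d : ℤ, a ^ 2 + 2 * b ^ 2 = m ∧ c ^ 2 + 2 * d ^ 2 = n ∧
          a * c - 2 * b * d = s ∧ a * d + b * c = t := by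
      intro m n s t hm hmn hN h hu
      obtain rfl | hm := hm.eq_or_lt
      · obtain rfl : s = 0 := by nlinarith
        obtain rfl : t = 0 := by nlinarith
        have := hu n (by simp) (by simp) (by simp) (by simp)
        obtain rfl : n = 1 := by
          rcases Int.isUnit_iff.1 this with h | h <;> omega
        exact ⟨0, 0, 1, 0, by norm_num⟩
      have hround : ∀ s : ℤ, ∃ k, 4 * (s - m * k) ^ 2 ≤ m ^ 2 := by
        intro s
        refine ⟨(2 * s + m) / (2 * m), ?_⟩
        have h1 := Int.emod_add_mul_ediv (2 * s + m) (2 * m)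
        have h2 := Int.emod_nonneg (2 * s + m) (b := 2 * m) (by omega)
        have h3 := Int.emod_lt_of_pos (2 * s + m) (b := 2 * m) (by omega)
        set k := (2 * s + m) / (2 * m)
        nlinarith
      obtain ⟨k, hk⟩ := hround s
      obtain ⟨j, hj⟩ := hround t
      have h' : (s - m * k) ^ 2 + 2 * (t - m * j) ^ 2 =
          m * (n - 2 * (s * k + 2 * t * j) + m * (k ^ 2 + 2 * j ^ 2)) := by
        linear_combination h
      have hn0 : 0 ≤ n - 2 * (s * k + 2 * t * j) + m * (k ^ 2 + 2 * j ^ 2) := by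
        refine nonneg_of_mul_nonneg_right (a := m) ?_ hm
        rw [← h']; positivity
      have hnlt : n - 2 * (s * k + 2 * t * j) + m * (k ^ 2 + 2 * j ^ 2) < m := by
        refine lt_of_mul_lt_mul_left (a := m) ?_ hm.le
        nlinarith
      obtain ⟨a, b, c, d, h1, h2, h3, h4⟩ := ih hm.le hn0 (by push_cast at hN; omega) h' (by
        intro p hpm hpn hps hpt
        have hs : p ∣ s := by
          have := hps.add (hpm.mul_right k)
          rwa [sub_add_cancel] at this
        have ht : p ∣ t := by
          have := hpt.add (hpm.mul_right j)
          rwa [sub_add_cancel] at this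
        refine hu p hpm ?_ hs ht
        have := (hpn.add ((hs.mul_right (2 * k)).add (ht.mul_right (4 * j)))).sub
          (hpm.mul_right (k ^ 2 + 2 * j ^ 2))
        have e : n = n - 2 * (s * k + 2 * t * j) + m * (k ^ 2 + 2 * j ^ 2) +
          (s * (2 * k) + t * (4 * j)) - m * (k ^ 2 + 2 * j ^ 2) := by ring
        rwa [e])
      subst h1
      refine ⟨a, b, c + (a * k + 2 * b * j), d + (a * j - b * k), rfl, ?_, ?_, ?_⟩
      · linear_combination h2 + 2 * k * h3 + 4 * j * h4
      · linear_combination h3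
      · linear_combination h4
    intro m n s t hm hn hN h hu
    rcases le_total m n with hmn | hmn
    · exact key hm hmn hN h hu
    · obtain ⟨a, b, c, d, h1, h2, h3, h4⟩ := key hn hmn (by omega) (by linarith : _ = n * m)
        (fun p h1 h2 => hu p h2 h1)
      exact ⟨c, d, a, b, h2, h1, by linarith, by linarith⟩

theorem Int.prime_dvd_of_forall_sq {l : ℕ} (hl : l.Prime) {D : ℤ} (hD : ¬IsSquare (D : ZMod l))
    (s t : ℤ) (h : (l : ℤ) ∣ s ^ 2 - D * t ^ 2) : (l : ℤ) ∣ s ∧ (l : ℤ) ∣ t := by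
  have := Fact.mk hl
  exact dvd_of_dvd_sq_sub_of_not_isSquare (Int.castRingHom (ZMod l))
    (fun s => (ZMod.intCast_zmod_eq_zero_iff_dvd s l).symm) hD s t h

/-- If `M` divides `s ^ 2 - D * t ^ 2` and no prime divides everything in sight, then `D` is a
quadratic residue modulo each prime dividing `M` to an odd power. -/
theorem jacobiSym_eq_one_of_mul_eq_norm {D : ℤ} {M : ℕ} {W s t : ℤ} (hM : M ≠ 0)
    (hD : ∀ l : ℕ, l.Prime → l ∣ M → ¬(l : ℤ) ∣ D) (h : M * W = s ^ 2 - D * t ^ 2)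
    (hp : ∀ l : ℕ, l.Prime → l ∣ M → (l : ℤ) ∣ W → (l : ℤ) ∣ s → (l : ℤ) ∣ t → False) :
    J(D | M) = 1 := by
  refine jacobiSym_eq_one_of_local hM fun l j M' hl hlM hj hM' => ?_
  have := Fact.mk hl
  have hl' := Nat.prime_iff_prime_int.1 hl
  rw [← jacobiSym.legendreSym.to_jacobiSym]
  rcases legendreSym.eq_one_or_neg_one l (a := D)
    (by rw [Ne, ZMod.intCast_zmod_eq_zero_iff_dvd]; exact hD l hl hlM) with h1 | h1
  · simp [h1]
  have hsq := Int.prime_dvd_of_forall_sq hl ((legendreSym.eq_neg_one_iff l).1 h1)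
  have hlM' : (l : ℤ) ∣ M := Int.natCast_dvd_natCast.2 hlM
  obtain ⟨hs, ht⟩ := hsq s t (h ▸ hlM'.mul_right W)
  have : Even j := by
    refine even_of_pow_mul_eq_norm (k := 1) (W := M' * W) hl' hl'.not_dvd_one hsq j
      (s := s) (t := t) ?_ ?_
    · intro hd
      rcases hl'.dvd_or_dvd hd with hd | hd
      · exact hM' (Int.natCast_dvd_natCast.1 hd)
      · exact hp l hl hlM hd hs ht
    · rw [one_mul, ← h, hj]
      push_cast; ring
  rw [h1, this.neg_one_pow]

instance : Zsqrtd.Nonsquare 17 := ⟨fun n h => by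
  have : n < 5 := by nlinarith
  interval_cases n <;> omega⟩

instance : IsDomain (ℤ√17) := inferInstanceAs (IsDomain (ℤ√((17 : ℕ) : ℤ)))

theorem Zsqrtd.natCast_dvd_of_dvd_norm {l : ℕ} (hl : l.Prime) {D : ℤ}
    (hD : ¬IsSquare (D : ZMod l)) {s : ℤ√D} (h : (l : ℤ) ∣ s.norm) : (l : ℤ√D) ∣ s := by
  have := Int.prime_dvd_of_forall_sq hl hD s.re s.im (by
    rw [Zsqrtd.norm_def] at h
    convert h using 1; ring)
  exact (Zsqrtd.intCast_dvd l s).2 this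

theorem Zsqrtd.natCast_dvd_iff_dvd_norm {l : ℕ} (hl : l.Prime) {D : ℤ}
    (hD : ¬IsSquare (D : ZMod l)) {s : ℤ√D} : (l : ℤ√D) ∣ s ↔ (l : ℤ) ∣ s.norm := by
  refine ⟨?_, Zsqrtd.natCast_dvd_of_dvd_norm hl hD⟩
  rintro ⟨s, rfl⟩
  rw [Zsqrtd.norm_mul, Zsqrtd.norm_natCast]
  exact (Dvd.intro _ rfl).mul_right _

theorem Zsqrtd.prime_natCast {l : ℕ} (hl : l.Prime) {D : ℤ} (hD : ¬IsSquare (D : ZMod l)) :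
    Prime (l : ℤ√D) := by
  have hl' := Nat.prime_iff_prime_int.1 hl
  refine ⟨by exact_mod_cast hl.ne_zero, fun h => ?_, fun s t h => ?_⟩
  · have := (Zsqrtd.natCast_dvd_iff_dvd_norm hl hD (s := 1)).1 h.dvd
    rw [Zsqrtd.norm_one] at this
    exact hl'.not_dvd_one this
  · simp only [Zsqrtd.natCast_dvd_iff_dvd_norm hl hD, Zsqrtd.norm_mul] at h ⊢
    exact hl'.dvd_or_dvd h

/-- If neither `D` nor its norm `-D` is a square modulo `l`, then `√D` is not a square in the field
`ℤ[√D] / l`. -/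
theorem Zsqrtd.dvd_of_dvd_sq_sub_sqrtd_mul_sq {l : ℕ} (hl : l.Prime) {D : ℤ}
    (hD : ¬IsSquare (D : ZMod l)) (hD' : ¬IsSquare ((-D : ℤ) : ZMod l)) (s t : ℤ√D)
    (h : (l : ℤ√D) ∣ s ^ 2 - Zsqrtd.sqrtd * t ^ 2) : (l : ℤ√D) ∣ s ∧ (l : ℤ√D) ∣ t := by
  simp only [Zsqrtd.natCast_dvd_iff_dvd_norm hl hD]
  refine Int.prime_dvd_of_forall_sq hl hD' _ _ ?_
  obtain ⟨w, hw⟩ := h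
  have e : s ^ 2 = Zsqrtd.sqrtd * t ^ 2 + (l : ℤ√D) * w := by linear_combination hw
  have e' := congrArg Zsqrtd.norm e
  have n1 : (s ^ 2).norm = s.norm ^ 2 := by rw [sq, Zsqrtd.norm_mul, sq]
  have n2 : (Zsqrtd.sqrtd * t ^ 2 : ℤ√D).norm = -D * t.norm ^ 2 := by
    rw [sq, Zsqrtd.norm_mul, Zsqrtd.norm_mul, Zsqrtd.norm_def Zsqrtd.sqrtd, sq]; simp
  rw [n1] at e'
  rw [e', ← n2]
  generalize (Zsqrtd.sqrtd * t ^ 2 : ℤ√D) = v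
  simp only [Zsqrtd.norm_def, Zsqrtd.re_add, Zsqrtd.im_add, Zsqrtd.re_mul, Zsqrtd.im_mul,
    Zsqrtd.re_natCast, Zsqrtd.im_natCast]
  exact Dvd.intro (2 * v.re * w.re + l * w.re ^ 2 - D * (2 * v.im * w.im + l * w.im ^ 2)) (by ring)

/-- The product formula over `ℚ(√17)` for the symbol `(P + Q√17, √17)`, away from `2`, `17` and the
infinite places, expressed through Jacobi symbols over `ℚ`. -/
theorem jacobiSym_mul_jacobiSym_of_norm_sqrt {P Q P' Q' b f y g p q : ℤ} {k M : ℕ}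
    (h1 : P * P' + 17 * Q * Q' = 2 * (f ^ 2 + 17 * b ^ 2))
    (h2 : P * Q' + Q * P' = 2 * (2 * b * f - y ^ 2))
    (hdiv : ∀ (R : Type) [CommRing R] [IsDomain R] (ϖ r : R), Prime ϖ → r ^ 2 = 17 → ¬ϖ ∣ 2 →
      ¬ϖ ∣ 17 → ϖ ∣ P + Q * r → ϖ ∣ P' + Q' * r → ϖ ∣ f + b * r → ϖ ∣ y → False)
    (hP : P = g * p) (hQ : Q = g * q) (hpq : IsCoprime p q) (hP17 : ¬17 ∣ P) (hg : Odd g)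
    (hM : (p ^ 2 - 17 * q ^ 2).natAbs = 2 ^ k * M) (hM2 : Odd M) :
    J(-(p * q) | M) * J(-17 | g.natAbs) = 1 := by
  have hg0 : g.natAbs ≠ 0 := by
    rintro h; rw [Int.natAbs_eq_zero] at h; simp [h] at hg
  have hM0 : M ≠ 0 := by rintro rfl; simp at hM2
  obtain ⟨σ, hσ, hσN⟩ : ∃ σ : ℤ, IsUnit σ ∧ p ^ 2 - 17 * q ^ 2 = σ * (2 ^ k * M) := by
    rcases Int.natAbs_eq (p ^ 2 - 17 * q ^ 2) with h | h
    · exact ⟨1, isUnit_one, by rw [h, hM]; push_cast; ring⟩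
    · exact ⟨-1, isUnit_one.neg, by rw [h, hM]; push_cast; ring⟩
  obtain ⟨τ, hτ, hτg⟩ : ∃ τ : ℤ, IsUnit τ ∧ g = τ * g.natAbs := by
    rcases Int.natAbs_eq g with h | h
    · exact ⟨1, isUnit_one, by rw [one_mul]; exact h⟩
    · exact ⟨-1, isUnit_one.neg, by rw [neg_one_mul]; exact h⟩
  refine jacobiSym_mul_jacobiSym_eq_one hM0 hg0 fun l i j M' g' hl hd hj hM' hi hg' => ?_
  have := Fact.mk hl
  have hl' := Nat.prime_iff_prime_int.1 hl
  have hl2 : l ≠ 2 := by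
    rintro rfl
    rcases hd with hd | hd
    · exact (Nat.not_even_iff_odd.2 hM2) (even_iff_two_dvd.2 hd)
    · exact (Nat.not_even_iff_odd.2 (Int.natAbs_odd.2 hg)) (even_iff_two_dvd.2 hd)
  have hl17 : l ≠ 17 := by
    rintro rfl
    rcases hd with hd | hd
    · have h : ((17 : ℕ) : ℤ) ∣ σ * (2 ^ k * M) :=
        ((Int.natCast_dvd_natCast.2 hd).mul_left _).mul_left _
      rw [← hσN] at h
      have h' : (17 : ℤ) ∣ p ^ 2 := by
        have := h.add (Dvd.intro (q ^ 2) rfl : (17 : ℤ) ∣ 17 * q ^ 2)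
        rwa [sub_add_cancel] at this
      exact hP17 (hP ▸ (hl'.dvd_of_dvd_pow h').mul_left g)
    · exact hP17 (hP ▸ (Int.natCast_dvd.2 hd).mul_right p)
  have hl2' : ¬(l : ℤ) ∣ 2 := fun h =>
    hl2 ((Nat.prime_dvd_prime_iff_eq hl Nat.prime_two).1 (by exact_mod_cast h))
  have hl17' : ¬(l : ℤ) ∣ 17 := fun h =>
    hl17 ((Nat.prime_dvd_prime_iff_eq hl (by norm_num)).1 (by exact_mod_cast h))
  have hg'' : ¬(l : ℤ) ∣ τ * g' := fun h =>
    (hl'.dvd_or_dvd h).elim (fun h => hl'.not_isUnit (isUnit_of_dvd_unit h hτ))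
      fun h => hg' (Int.natCast_dvd_natCast.1 h)
  have hM'' : ¬(l : ℤ) ∣ σ * (2 ^ k * M') := fun h =>
    (hl'.dvd_or_dvd h).elim (fun h => hl'.not_isUnit (isUnit_of_dvd_unit h hσ)) fun h =>
      (hl'.dvd_or_dvd h).elim (fun h => hl2' (hl'.dvd_of_dvd_pow h))
        fun h => hM' (Int.natCast_dvd_natCast.1 h)
  have hN : p ^ 2 - 17 * q ^ 2 = l ^ j * (σ * (2 ^ k * M')) := by
    rw [hσN, hj]; push_cast; ring
  have hg1 : g = l ^ i * (τ * g') := by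
    rw [hτg, hi]; push_cast; ring
  have key : ∀ (R : Type) [CommRing R] [IsDomain R] (r : R), r ^ 2 = 17 →
      (∀ n : ℤ, (l : R) ∣ n → (l : ℤ) ∣ n) → Prime (l : R) →
      (∀ s t, (l : R) ∣ s ^ 2 - r * t ^ 2 → (l : R) ∣ s ∧ (l : R) ∣ t) →
      ∀ (m : ℕ) (u v : R), ¬(l : R) ∣ u → ¬(l : R) ∣ v → u * (P + Q * r) = l ^ m * v →
      Even m := by
    intro R _ _ r hr hR hlR hsq m u v hu hv huv
    have e : ((P : R) + Q * r) * (P' + Q' * r) = 2 * ((f + b * r) ^ 2 - r * y ^ 2) := by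
      have h1' := congrArg (Int.cast : ℤ → R) h1
      have h2' := congrArg (Int.cast : ℤ → R) h2
      push_cast at h1' h2'
      linear_combination h1' + r * h2' + (Q * Q' - 2 * b ^ 2 : R) * hr
    have h2R : ¬(l : R) ∣ 2 := fun h => hl2' (hR 2 (by exact_mod_cast h))
    have h17R : ¬(l : R) ∣ 17 := fun h => hl17' (hR 17 (by exact_mod_cast h))
    obtain rfl | hm := Nat.eq_zero_or_pos m
    · exact Even.zero
    refine even_of_pow_mul_eq_norm (k := 2 * u) (W := v * (P' + Q' * r)) hlR
      (fun h => (hlR.dvd_or_dvd h).elim h2R hu) hsq m (s := f + b * r) (t := y) (fun h => ?_) ?_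
    · have hT' := (hlR.dvd_or_dvd h).resolve_left hv
      have hT : (l : R) ∣ P + Q * r :=
        (hlR.dvd_or_dvd (huv ▸ (dvd_pow_self (l : R) hm.ne').mul_right v)).resolve_left hu
      obtain ⟨hs, ht⟩ := hsq _ _ ((hlR.dvd_or_dvd (e ▸ hT.mul_right _)).resolve_left h2R)
      exact hdiv R l r hlR hr h2R h17R hT hT' hs ht
    · linear_combination u * e - (P' + Q' * r) * huv
  have hcop : ∀ (R : Type) [CommRing R] (ϖ : R), Prime ϖ → ϖ ∣ p → ϖ ∣ q → False := by
    intro R _ ϖ hϖ hp hq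
    obtain ⟨u, v, huv⟩ := hpq
    have huv' := congrArg (Int.cast : ℤ → R) huv
    push_cast at huv'
    exact hϖ.not_isUnit (isUnit_of_dvd_one (huv' ▸ (hp.mul_left _).add (hq.mul_left _)))
  have h17 : (17 : ZMod l) ≠ 0 := fun h => hl17' <| by
    rw [← ZMod.intCast_zmod_eq_zero_iff_dvd]; exact_mod_cast h
  have h17J : ((-17 : ℤ) : ZMod l) ≠ 0 := by push_cast; simpa using h17
  rw [← jacobiSym.legendreSym.to_jacobiSym, ← jacobiSym.legendreSym.to_jacobiSym]
  by_cases hsq : IsSquare (17 : ZMod l)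
  · have hdvd : ∀ n : ℤ, (l : ℤ_[l]) ∣ n → (l : ℤ) ∣ n := fun n h =>
      (PadicInt.norm_int_lt_one_iff_dvd n).1 ((PadicInt.norm_lt_one_iff_dvd _).2 h)
    have hprime : Prime (l : ℤ_[l]) := PadicInt.prime_p
    have hε : ∀ s : ℤ_[l], (l : ℤ_[l]) ∣ s ↔ PadicInt.toZMod s = 0 := fun s => by
      rw [← RingHom.mem_ker, PadicInt.ker_toZMod, PadicInt.maximalIdeal_eq_span_p,
        Ideal.mem_span_singleton]
    have h2R : ¬(l : ℤ_[l]) ∣ 2 := fun h => hl2' (hdvd 2 (by exact_mod_cast h))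
    have h17R : ¬(l : ℤ_[l]) ∣ 17 := fun h => hl17' (hdvd 17 (by exact_mod_cast h))
    obtain ⟨ρ, hρ, hu⟩ : ∃ ρ : ℤ_[l], ρ ^ 2 = 17 ∧ ¬(l : ℤ_[l]) ∣ p - q * ρ := by
      obtain ⟨ρ, hρ⟩ := exists_padicInt_sq_eq_of_isSquare hl2 hl17 hsq
      by_contra! h
      have h1 := h ρ hρ
      have h2 := h (-ρ) (by rw [neg_sq, hρ])
      have hp : (l : ℤ_[l]) ∣ 2 * p := by
        have := h1.add h2
        ring_nf at this ⊢
        exact this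
      have hq : (l : ℤ_[l]) ∣ 2 * (q * 17) := by
        have : (l : ℤ_[l]) ∣ ρ * ((p - q * -ρ) - (p - q * ρ)) := (h2.sub h1).mul_left _
        rw [← hρ]
        ring_nf at this ⊢
        exact this
      exact hcop ℤ_[l] l hprime ((hprime.dvd_or_dvd hp).resolve_left h2R)
        ((hprime.dvd_or_dvd ((hprime.dvd_or_dvd hq).resolve_left h2R)).resolve_right h17R)
    set x : ZMod l := PadicInt.toZMod ρ with hx
    have hx17 : x ^ 2 = 17 := by rw [hx, ← map_pow, hρ, map_ofNat]
    have hx0 : x ≠ 0 := by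
      rintro h
      rw [h] at hx17
      exact h17 (by simpa using hx17.symm)
    have hij : ¬IsSquare x → Even (i + j) := fun hns => by
      have hN' := congrArg (Int.cast : ℤ → ℤ_[l]) hN
      push_cast at hN'
      refine key ℤ_[l] ρ hρ hdvd hprime
        (dvd_of_dvd_sq_sub_of_not_isSquare PadicInt.toZMod hε hns) (i + j) (p - q * ρ)
        ((τ * g' : ℤ) * (σ * (2 ^ k * M') : ℤ)) hu (fun h => ?_) ?_
      · exact (hprime.dvd_or_dvd h).elim (fun h => hg'' (hdvd _ h)) fun h => hM'' (hdvd _ h)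
      · rw [hP, hQ, hg1]
        push_cast
        linear_combination (l ^ i * (τ * g') : ℤ_[l]) * (hN' - (q : ℤ_[l]) ^ 2 * hρ)
    have hi : ¬IsSquare (-x) → Even i := fun hns => by
      refine key ℤ_[l] (-ρ) (by rw [neg_sq, hρ]) hdvd hprime
        (dvd_of_dvd_sq_sub_of_not_isSquare PadicInt.toZMod hε (by rwa [map_neg])) i 1
        ((τ * g' : ℤ) * (p - q * ρ)) hprime.not_dvd_one (fun h => ?_) ?_
      · exact (hprime.dvd_or_dvd h).elim (fun h => hg'' (hdvd _ h)) hu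
      · rw [hP, hQ, hg1]
        push_cast
        ring
    have hxx : ((-17 : ℤ) : ZMod l) = x * -x := by
      push_cast; rw [← hx17]; ring
    have hD : j ≠ 0 → legendreSym l (-(p * q)) = quadraticChar (ZMod l) x := fun hj0 => by
      have h1 : (l : ℤ_[l]) ∣ (p - q * ρ) * (p + q * ρ) := by
        have hN' := congrArg (Int.cast : ℤ → ℤ_[l]) hN
        push_cast at hN'
        have e : ((p : ℤ_[l]) - q * ρ) * (p + q * ρ) = l ^ j * (σ * (2 ^ k * M')) := by
          linear_combination hN' - (q : ℤ_[l]) ^ 2 * hρ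
        exact e ▸ (dvd_pow_self (l : ℤ_[l]) hj0).mul_right _
      have h2 := (hε _).1 ((hprime.dvd_or_dvd h1).resolve_left hu)
      simp only [map_add, map_mul, map_intCast, ← hx] at h2
      have hq0 : (q : ZMod l) ≠ 0 := fun hq => by
        rw [hq, zero_mul, add_zero] at h2
        rw [ZMod.intCast_zmod_eq_zero_iff_dvd] at hq h2
        exact hcop ℤ l hl' h2 hq
      have e : ((-(p * q) : ℤ) : ZMod l) = (q : ZMod l) ^ 2 * x := by
        push_cast; linear_combination (-q : ZMod l) * h2
      rw [legendreSym, e, map_mul, map_pow, quadraticChar_sq_one hq0, one_mul]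
    have h17L : legendreSym l (-17) =
        quadraticChar (ZMod l) x * quadraticChar (ZMod l) (-x) := by
      rw [legendreSym, hxx, map_mul]
    rw [h17L]
    have e : legendreSym l (-(p * q)) ^ j = quadraticChar (ZMod l) x ^ j := by
      rcases eq_or_ne j 0 with rfl | hj0
      · simp
      · rw [hD hj0]
    rw [e, mul_pow, ← mul_assoc, ← pow_add, add_comm j i]
    have c1 : quadraticChar (ZMod l) x ^ (i + j) = 1 := by
      rcases quadraticChar_dichotomy hx0 with h | h
      · rw [h, one_pow]
      · rw [h, (hij (quadraticChar_neg_one_iff_not_isSquare.1 h)).neg_one_pow]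
    have c2 : quadraticChar (ZMod l) (-x) ^ i = 1 := by
      rcases quadraticChar_dichotomy (neg_ne_zero.2 hx0) with h | h
      · rw [h, one_pow]
      · rw [h, (hi (quadraticChar_neg_one_iff_not_isSquare.1 h)).neg_one_pow]
    rw [c1, c2, one_mul]
  · have hsq' : ¬IsSquare ((17 : ℤ) : ZMod l) := by exact_mod_cast hsq
    have hj0 : j = 0 := by
      by_contra hj0
      have : (l : ℤ) ∣ p ^ 2 - 17 * q ^ 2 := hN ▸ (dvd_pow_self (l : ℤ) hj0).mul_right _
      obtain ⟨hp, hq⟩ := Int.prime_dvd_of_forall_sq hl hsq' p q this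
      exact hcop ℤ l hl' hp hq
    rw [hj0, pow_zero, one_mul]
    rcases legendreSym.eq_one_or_neg_one l h17J with h1 | h1
    · simp [h1]
    have hprime : Prime (l : ℤ√17) := Zsqrtd.prime_natCast hl hsq'
    have hdvd : ∀ n : ℤ, (l : ℤ√17) ∣ n → (l : ℤ) ∣ n := fun n h =>
      (Zsqrtd.intCast_dvd_intCast (d := 17) l n).1 (by rwa [Int.cast_natCast])
    have : Even i := by
      refine key (ℤ√17) Zsqrtd.sqrtd (by rw [sq, Zsqrtd.dmuld]; rfl) hdvd hprime
        (Zsqrtd.dvd_of_dvd_sq_sub_sqrtd_mul_sq hl hsq' ((legendreSym.eq_neg_one_iff l).1 h1)) i 1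
        (((τ * g' : ℤ) : ℤ√17) * ((p : ℤ√17) + (q : ℤ√17) * Zsqrtd.sqrtd))
        hprime.not_dvd_one (fun h => ?_) ?_
      · rcases hprime.dvd_or_dvd h with h | h
        · exact hg'' (hdvd _ h)
        · have := (Zsqrtd.intCast_dvd (l : ℤ) ((p : ℤ√17) + (q : ℤ√17) * Zsqrtd.sqrtd)).1
            (by rwa [Int.cast_natCast])
          simp only [Zsqrtd.re_add, Zsqrtd.im_add, Zsqrtd.re_mul, Zsqrtd.im_mul, Zsqrtd.re_intCast,
            Zsqrtd.im_intCast, Zsqrtd.re_sqrtd, Zsqrtd.im_sqrtd, mul_zero, mul_one,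
            add_zero, zero_add] at this
          exact hcop ℤ l hl' this.1 this.2
      · rw [hP, hQ, hg1]
        push_cast; ring
    rw [h1, this.neg_one_pow]

theorem jacobiSym_eq_jacobiSym_natAbs_s15 {D : ℤ} {M : ℕ} (hD : D % 4 = 1) (hM : Odd M) :
    J(D | M) = J(M | D.natAbs) := by
  rcases Int.natAbs_eq D with h | h
  · conv_lhs => rw [h]
    exact jacobiSym.quadratic_reciprocity_one_mod_four (by omega) hM
  · conv_lhs => rw [h]
    have h3 : D.natAbs % 4 = 3 := by omega
    have hn : Odd D.natAbs := Nat.odd_iff.2 (by omega)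
    rw [jacobiSym.neg _ hM]
    rcases Nat.odd_mod_four_iff.1 (Nat.odd_iff.1 hM) with h1 | h1
    · rw [ZMod.χ₄_nat_one_mod_four h1, one_mul,
        jacobiSym.quadratic_reciprocity_one_mod_four' hn h1]
    · rw [ZMod.χ₄_nat_three_mod_four h1, jacobiSym.quadratic_reciprocity_three_mod_four h3 h1]
      ring

theorem jacobiSym_seventeen_natAbs (P : ℤ) (hP : Odd P) : J(17 | P.natAbs) = J(P | 17) := by
  have h := jacobiSym.quadratic_reciprocity_one_mod_four (a := 17) (b := P.natAbs) (by norm_num)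
    (Int.natAbs_odd.2 hP)
  push_cast at h
  rw [h]
  rcases abs_choice P with h | h <;> rw [h]
  rw [jacobiSym.neg _ (by decide)]
  simp [show ZMod.χ₄ (17 : ZMod 4) = 1 by decide]

theorem odd_exponent_or_mul_emod_eight {p q : ℤ} {k M : ℕ} (hpq : p * q % 4 = 3)
    (hM : (p ^ 2 - 17 * q ^ 2).natAbs = 2 ^ k * M) (hM2 : Odd M) :
    Odd k ∨ p * q % 8 = 7 := by
  by_contra! h
  have h3 : p * q % 8 = 3 := by omega
  have hN : (p ^ 2 - 17 * q ^ 2) % 16 = 8 := by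
    have key : ∀ a b : ZMod 16, (a * b = 3 ∨ a * b = 11) → a ^ 2 - 17 * b ^ 2 = 8 := by decide
    have := key p q (by
      rcases (by omega : p * q % 16 = 3 ∨ p * q % 16 = 11) with h | h
      · left; exact_mod_cast (ZMod.intCast_eq_intCast_iff (p * q) 3 16).2 h
      · right; exact_mod_cast (ZMod.intCast_eq_intCast_iff (p * q) 11 16).2 h)
    exact (ZMod.intCast_eq_intCast_iff (p ^ 2 - 17 * q ^ 2) 8 16).1 (by exact_mod_cast this)
  have hn : 2 ^ k * M % 16 = 8 := by omega
  obtain ⟨m, rfl⟩ := hM2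
  match k, h.1, hn with
  | 0, _, h => omega
  | 2, _, h => omega
  | k + 4, _, h => rw [pow_add, mul_assoc, mul_comm, mul_assoc] at h; omega

theorem jacobiSym_seventeen_of_norm_sqrt {P Q P' Q' b f y : ℤ}
    (h1 : P * P' + 17 * Q * Q' = 2 * (f ^ 2 + 17 * b ^ 2))
    (h2 : P * Q' + Q * P' = 2 * (2 * b * f - y ^ 2))
    (hdiv : ∀ (R : Type) [CommRing R] [IsDomain R] (ϖ r : R), Prime ϖ → r ^ 2 = 17 → ¬ϖ ∣ 2 →
      ¬ϖ ∣ 17 → ϖ ∣ P + Q * r → ϖ ∣ P' + Q' * r → ϖ ∣ f + b * r → ϖ ∣ y → False)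
    (hP17 : ¬17 ∣ P) (hPQ : P * Q % 4 = 3) (hlt : (P : ℝ) < √17 * Q) :
    J(P | 17) = -(ZMod.χ₈ (P * Q : ℤ) * ZMod.χ₄ P) := by
  have hodd : Odd (P * Q) := Int.odd_iff.2 (by omega)
  obtain ⟨hPo, hQo⟩ := Int.odd_mul.1 hodd
  have hP0 : P ≠ 0 := by rintro rfl; simp at hP17
  obtain ⟨g, p, q, hg, hpq, hP, hQ⟩ :
      ∃ g p q : ℤ, 0 < g ∧ IsCoprime p q ∧ P = g * p ∧ Q = g * q := by
    have hpos : 0 < P.gcd Q := Int.gcd_pos_of_ne_zero_left _ hP0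
    obtain ⟨p, q, hpq, hP, hQ⟩ := Int.exists_gcd_one hpos
    exact ⟨P.gcd Q, p, q, by exact_mod_cast hpos, Int.isCoprime_iff_gcd_eq_one.2 hpq,
      by rw [mul_comm]; exact hP, by rw [mul_comm]; exact hQ⟩
  obtain ⟨hgo, hpo⟩ := Int.odd_mul.1 (hP ▸ hPo)
  have hqo : Odd q := (Int.odd_mul.1 (hQ ▸ hQo)).2
  have h8 : P * Q % 8 = p * q % 8 := by
    obtain ⟨m, hm⟩ := Int.eight_dvd_sq_sub_one_of_odd hgo
    have : P * Q = p * q + 8 * (m * (p * q)) := by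
      rw [hP, hQ]; linear_combination (p * q) * hm
    omega
  have h8' : ((P * Q : ℤ) : ZMod 8) = (p * q : ℤ) := (ZMod.intCast_eq_intCast_iff _ _ 8).2 h8
  obtain ⟨k, M, hM2, hM⟩ := Nat.exists_eq_two_pow_mul_odd (n := (p ^ 2 - 17 * q ^ 2).natAbs) (by
    rw [Int.natAbs_ne_zero]
    intro h
    exact hP17 (hP ▸ ((Nat.prime_iff_prime_int.1 (by norm_num : Nat.Prime 17)).dvd_of_dvd_pow
      (n := 2) ⟨q ^ 2, by push_cast; linear_combination h⟩).mul_left g))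
  have main := jacobiSym_mul_jacobiSym_of_norm_sqrt h1 h2 hdiv hP hQ hpq hP17 hgo hM hM2
  have hpq3 : p * q % 4 = 3 := by omega
  have hpqo : Odd (p * q).natAbs := Int.natAbs_odd.2 (hpo.mul hqo)
  have hp0 : p.natAbs ≠ 0 := by
    rintro h; rw [Int.natAbs_eq_zero] at h; simp [h] at hpo
  obtain ⟨σ, hσ, hσN⟩ : ∃ σ : ℤ, (σ = 1 ∧ 0 ≤ p ^ 2 - 17 * q ^ 2 ∨ σ = -1 ∧ p ^ 2 - 17 * q ^ 2 ≤ 0) ∧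
      2 ^ k * M = σ * (p ^ 2 - 17 * q ^ 2) := by
    have hM' : ((p ^ 2 - 17 * q ^ 2).natAbs : ℤ) = 2 ^ k * M := by rw [hM]; push_cast; rfl
    rcases le_total 0 (p ^ 2 - 17 * q ^ 2) with h | h
    · exact ⟨1, Or.inl ⟨rfl, h⟩, by omega⟩
    · exact ⟨-1, Or.inr ⟨rfl, h⟩, by omega⟩
  have e1 : J(-(p * q) | M) = J(M | (p * q).natAbs) := by
    rw [jacobiSym_eq_jacobiSym_natAbs_s15 (by omega) hM2, Int.natAbs_neg]
  have e2 : J(p ^ 2 - 17 * q ^ 2 | (p * q).natAbs) = J(-17 | p.natAbs) := by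
    have hcop : q.gcd p.natAbs = 1 := by
      rw [Int.gcd_comm, Int.gcd_eq_natAbs_gcd_natAbs, Int.natAbs_natCast]
      exact Int.isCoprime_iff_gcd_eq_one.1 hpq
    have hcop' : p.gcd q.natAbs = 1 := by
      rw [Int.gcd_eq_natAbs_gcd_natAbs, Int.natAbs_natCast]
      exact Int.isCoprime_iff_gcd_eq_one.1 hpq
    have hmod : ∀ {a b c : ℤ}, c ∣ a - b → a % c.natAbs = b % c.natAbs := fun h =>
      Int.emod_eq_emod_iff_emod_sub_eq_zero.2 (Int.emod_eq_zero_of_dvd (Int.natAbs_dvd.2 h))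
    have a1 : J(p ^ 2 - 17 * q ^ 2 | p.natAbs) = J(-17 | p.natAbs) := by
      rw [← mul_one J(-17 | p.natAbs), ← jacobiSym.sq_one' hcop, ← jacobiSym.mul_left]
      exact jacobiSym.mod_left' (hmod ⟨p, by ring⟩)
    have a2 : J(p ^ 2 - 17 * q ^ 2 | q.natAbs) = 1 := by
      rw [← jacobiSym.sq_one' hcop']
      exact jacobiSym.mod_left' (hmod ⟨-17 * q, by ring⟩)
    rw [Int.natAbs_mul, jacobiSym.mul_right' _ hp0 (by
      rintro h; rw [Int.natAbs_eq_zero] at h; simp [h] at hqo), a1, a2, mul_one]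
  have e3 : J(2 | (p * q).natAbs) ^ k * J(M | (p * q).natAbs) =
      J(σ | (p * q).natAbs) * J(-17 | p.natAbs) := by
    rw [← jacobiSym.pow_left, ← jacobiSym.mul_left, hσN, jacobiSym.mul_left, e2]
  have e4 : J(2 | (p * q).natAbs) ^ k = ZMod.χ₈ (p * q : ℤ) := by
    have : J(2 | (p * q).natAbs) = ZMod.χ₈ (p * q : ℤ) := by
      rw [jacobiSym.at_two hpqo]
      rcases Int.natAbs_eq (p * q) with h | h
      · conv_rhs => rw [h]
        simp
      · conv_rhs => rw [h]
        have : ∀ x : ZMod 8, ZMod.χ₈ x = ZMod.χ₈ (-x) := by decide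
        rw [this]; simp
    rcases odd_exponent_or_mul_emod_eight hpq3 hM hM2 with h | h
    · rw [← this]
      obtain ⟨m, rfl⟩ := h
      rw [pow_succ, pow_mul, jacobiSym.sq_one, one_pow, one_mul]
      rw [Int.gcd_eq_natAbs_gcd_natAbs, Int.natAbs_natCast]
      exact hpqo.coprime_two_left
    · have h' : ((p * q : ℤ) : ZMod 8) = (7 : ℤ) := (ZMod.intCast_eq_intCast_iff _ _ 8).2 h
      rw [this, h', show ZMod.χ₈ ((7 : ℤ) : ZMod 8) = 1 by decide, one_pow]
  have e5 : J(-17 | P.natAbs) = J(-17 | g.natAbs) * J(-17 | p.natAbs) := by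
    rw [hP, Int.natAbs_mul, jacobiSym.mul_right' _ (by omega) hp0]
  have e6 : J(-17 | P.natAbs) = ZMod.χ₄ P.natAbs * J(P | 17) := by
    rw [jacobiSym.neg _ (Int.natAbs_odd.2 hPo), jacobiSym_seventeen_natAbs P hPo]
  have e7 : J(σ | (p * q).natAbs) * ZMod.χ₄ P.natAbs = -ZMod.χ₄ P := by
    have hneg : ∀ x : ZMod 4, ZMod.χ₄ (-x) = -ZMod.χ₄ x := by decide
    have h17 : √17 ^ 2 = (17 : ℝ) := Real.sq_sqrt (by norm_num)
    have hgR : (0 : ℝ) < g := by exact_mod_cast hg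
    have hlt' : (p : ℝ) < √17 * q := by
      rw [hP, hQ] at hlt; push_cast at hlt
      nlinarith
    have h0 : 0 < √(17 : ℝ) := by positivity
    rcases hσ with ⟨rfl, h⟩ | ⟨rfl, h⟩
    · have hR : 0 ≤ (p : ℝ) ^ 2 - 17 * q ^ 2 := by exact_mod_cast h
      have hp : p < 0 := by
        have : (p : ℝ) < 0 := by
          by_contra! h'
          nlinarith
        exact_mod_cast this
      have hPn : P < 0 := hP ▸ mul_neg_of_pos_of_neg hg hp
      have : ((P.natAbs : ℤ) : ZMod 4) = -P := by
        rw [Int.ofNat_natAbs_of_nonpos hPn.le]; push_cast; rfl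
      rw [jacobiSym.one_left, one_mul, ← hneg, ← this]; simp
    · have hR : (p : ℝ) ^ 2 - 17 * q ^ 2 ≤ 0 := by exact_mod_cast h
      have hq : 0 < q := by
        have : (0 : ℝ) < q := by
          by_contra! h'
          have := mul_nonneg h0.le (neg_nonneg.2 h')
          nlinarith [mul_pos (sub_pos.2 hlt') (by linarith : 0 < -(p + √17 * q))]
        exact_mod_cast this
      rw [jacobiSym.at_neg_one hpqo]
      rcases lt_or_ge 0 p with hp | hp
      · have hPn : 0 < P := hP ▸ mul_pos hg hp
        have : ((P.natAbs : ℤ) : ZMod 4) = P := by rw [Int.natAbs_of_nonneg hPn.le]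
        have hn := Int.natAbs_of_nonneg (mul_pos hp hq).le
        rw [ZMod.χ₄_nat_three_mod_four (by omega), ← this]; simp
      · have hPn : P ≤ 0 := hP ▸ mul_nonpos_of_nonneg_of_nonpos hg.le hp
        have : ((P.natAbs : ℤ) : ZMod 4) = -P := by
          rw [Int.ofNat_natAbs_of_nonpos hPn]; push_cast; rfl
        have hn := Int.ofNat_natAbs_of_nonpos (mul_nonpos_of_nonpos_of_nonneg hp hq.le)
        rw [ZMod.χ₄_nat_one_mod_four (by omega), one_mul, ← hneg, ← this]; simp
  have e8 : ZMod.χ₄ (P : ZMod 4) ^ 2 = 1 := by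
    rcases Int.emod_two_eq_zero_or_one P with h | h
    · exact absurd (Int.odd_iff.1 hPo) (by omega)
    · rcases (by omega : P % 4 = 1 ∨ P % 4 = 3) with h | h
      · rw [ZMod.χ₄_int_one_mod_four h]; norm_num
      · rw [ZMod.χ₄_int_three_mod_four h]; norm_num
  rw [e1] at main
  rw [e4] at e3
  rw [h8']
  have e9 : ZMod.χ₈ (p * q : ℤ) = -(ZMod.χ₄ P * J(P | 17)) := by
    linear_combination (-ZMod.χ₈ (p * q : ℤ)) * main + J(-17 | g.natAbs) * e3 -
      J(σ | (p * q).natAbs) * e5 + J(σ | (p * q).natAbs) * e6 + J(P | 17) * e7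
  linear_combination (-J(P | 17)) * e8 + ZMod.χ₄ P * e9

theorem jacobiSym_eq_of_dvd_sub {m n : ℤ} {p : ℕ} (h : (p : ℤ) ∣ m - n) : J(m | p) = J(n | p) :=
  jacobiSym.mod_left' (Int.emod_eq_emod_iff_emod_sub_eq_zero.2 (Int.emod_eq_zero_of_dvd h))

theorem jacobiSym_seventeen_neg (n : ℤ) : J(-n | 17) = J(n | 17) := by
  rw [jacobiSym.neg _ (by decide), show ZMod.χ₄ ((17 : ℕ) : ZMod 4) = 1 by decide, one_mul]

theorem jacobiSym_seventeen_eq_zero_iff {n : ℤ} : J(n | 17) = 0 ↔ 17 ∣ n := by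
  have : Fact (Nat.Prime 17) := ⟨by norm_num⟩
  rw [← jacobiSym.legendreSym.to_jacobiSym, legendreSym.eq_zero_iff,
    ZMod.intCast_zmod_eq_zero_iff_dvd]
  rfl

theorem jacobiSym_seventeen_sq {n : ℤ} (h : ¬17 ∣ n) : J(n | 17) ^ 2 = 1 := by
  rcases jacobiSym.trichotomy n 17 with h' | h' | h'
  · exact absurd (jacobiSym_seventeen_eq_zero_iff.1 h') h
  · rw [h']; rfl
  · rw [h']; rfl

theorem Int.prime_seventeen : Prime (17 : ℤ) :=
  Nat.prime_iff_prime_int.1 (by norm_num : Nat.Prime 17)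

/-- If `a ^ 2 + 2 * b ^ 2 ≡ 2 * z ^ 2` modulo `17`, then up to the sign of `b` the quadratic
characters of `z - b` and `a - 7 * b` are opposite. -/
theorem exists_jacobiSym_seventeen_eq_neg {a b z : ℤ} (h : 17 ∣ a ^ 2 + 2 * b ^ 2 - 2 * z ^ 2)
    (h0 : ¬17 ∣ a - 7 * b) :
    ∃ b', (b' = b ∨ b' = -b) ∧ ¬17 ∣ z - b' ∧ J(z - b' | 17) = -J(a - 7 * b | 17) := by
  have key : ∀ a b : ℤ, 17 ∣ a ^ 2 + 2 * b ^ 2 - 2 * z ^ 2 → ¬17 ∣ a - 7 * b → ¬17 ∣ z - b →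
      J(z - b | 17) = -J(a - 7 * b | 17) := by
    intro a b ⟨m, hm⟩ h0 h1
    have h2 : J(3 * ((z - b) * (a - 7 * b)) | 17) = J((4 * a + 6 * b + 11 * z) ^ 2 | 17) :=
      jacobiSym_eq_of_dvd_sub ⟨m - a ^ 2 - b ^ 2 - 7 * z ^ 2 - 5 * a * z - 9 * b * z - 3 * a * b, by
        push_cast; linear_combination hm⟩
    rw [jacobiSym.mul_left, jacobiSym.mul_left, jacobiSym.pow_left,
      show J(3 | 17) = -1 by norm_num] at h2
    have h3 := jacobiSym_seventeen_sq h0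
    rcases jacobiSym.trichotomy (4 * a + 6 * b + 11 * z) 17 with h4 | h4 | h4
    · rw [h4] at h2
      have : J(z - b | 17) * J(a - 7 * b | 17) = 0 := by linarith
      rcases mul_eq_zero.1 this with h | h
      · exact absurd (jacobiSym_seventeen_eq_zero_iff.1 h) h1
      · exact absurd (jacobiSym_seventeen_eq_zero_iff.1 h) h0
    all_goals
      rw [h4] at h2
      linear_combination (-J(a - 7 * b | 17)) * h2 - J(z - b | 17) * h3
  by_cases h1 : 17 ∣ z - b
  · by_cases h2 : 17 ∣ z + b
    · refine absurd ?_ h0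
      have hb : 17 ∣ b := by omega
      have hz : 17 ∣ z := by omega
      have ha : 17 ∣ a ^ 2 := by
        have e : a ^ 2 = (a ^ 2 + 2 * b ^ 2 - 2 * z ^ 2) - b * (2 * b) + z * (2 * z) := by ring
        rw [e]
        exact (h.sub (hb.mul_right _)).add (hz.mul_right _)
      exact (Int.prime_seventeen.dvd_of_dvd_pow ha).sub (hb.mul_left 7)
    · have h2' : ¬17 ∣ z - -b := by rwa [sub_neg_eq_add]
      refine ⟨-b, Or.inr rfl, h2', ?_⟩
      rw [key (-a) (-b) (by rwa [neg_sq, neg_sq]) (by omega) h2', ← jacobiSym_seventeen_neg]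
      congr 2; ring
  · exact ⟨b, Or.inl rfl, h1, key a b h h0 h1⟩

theorem χ₈_mul_χ₄_eq_one {P Q : ℤ} (hP : Odd P) (h : (Q : ZMod 8) = P - 2) :
    ZMod.χ₈ (P * Q : ℤ) * ZMod.χ₄ P = 1 := by
  have key : ∀ p : ZMod 8, p * p = 1 →
      ZMod.χ₈ (p * (p - 2)) * ZMod.χ₄ (ZMod.castHom (by norm_num : 4 ∣ 8) (ZMod 4) p) = 1 := by
    decide
  have := key P (by
    obtain ⟨m, hm⟩ := Int.eight_dvd_sq_sub_one_of_odd hP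
    have e : P * P = 1 + 8 * m := by linear_combination hm
    have := congrArg (Int.cast : ℤ → ZMod 8) e
    push_cast at this
    rw [this, show (8 : ZMod 8) = 0 by decide, zero_mul, add_zero])
  rwa [map_intCast, ← h, ← Int.cast_mul] at this

theorem Prime.dvd_of_dvd_sub_of_dvd_add {R : Type*} [CommRing R] {l z b : R} (hl : Prime l)
    (hl2 : ¬l ∣ 2) (h1 : l ∣ z - b) (h2 : l ∣ z + b) : l ∣ z ∧ l ∣ b := by
  have hz : l ∣ 2 * z := by
    have := h1.add h2; rwa [show z - b + (z + b) = 2 * z by ring] at this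
  have hb : l ∣ 2 * b := by
    have := h2.sub h1; rwa [show z + b - (z - b) = 2 * b by ring] at this
  exact ⟨(hl.dvd_or_dvd hz).resolve_left hl2, (hl.dvd_or_dvd hb).resolve_left hl2⟩

theorem χ₄_mul_jacobiSym_sub_eq_one {a b x z : ℤ} (h : a ^ 2 + 2 * b ^ 2 = 2 * z ^ 2 - 17 * x ^ 2)
    (hz : 0 < z) (hx : x ≠ 0) (hodd : Odd (z - b)) (h17 : ¬17 ∣ z - b)
    (hcop : ∀ l : ℕ, l.Prime → (l : ℤ) ∣ a → (l : ℤ) ∣ b → (l : ℤ) ∣ x → (l : ℤ) ∣ z → False) :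
    ZMod.χ₄ (z - b : ℤ) * J(z - b | 17) = 1 := by
  have hx2 : 0 < x ^ 2 := by positivity
  have hpos : 0 < z - b := by
    have : b ^ 2 < z ^ 2 := by nlinarith [sq_nonneg a]
    linarith [(abs_lt.1 (abs_lt_of_sq_lt_sq this hz.le)).2]
  obtain ⟨n, hn⟩ := Int.eq_ofNat_of_zero_le hpos.le
  have hnodd : Odd n := by rw [hn] at hodd; exact_mod_cast hodd
  have key : J(-17 | n) = 1 := by
    refine jacobiSym_eq_one_of_mul_eq_norm (W := 2 * (z + b)) (s := a) (t := x)
      (by rintro rfl; simp at hnodd) (fun l hl hd h => ?_) ?_ (fun l hl hd hW hs ht => ?_)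
    · have h' : l ∣ 17 := Int.natCast_dvd_natCast.1 (by simpa using h)
      rw [(Nat.prime_dvd_prime_iff_eq hl (by norm_num)).1 h'] at hd
      exact h17 (hn ▸ by exact_mod_cast hd)
    · rw [← hn]; linear_combination -h
    · have hl2 : ¬(l : ℤ) ∣ 2 := fun h => by
        rw [(Nat.prime_dvd_prime_iff_eq hl Nat.prime_two).1 (by exact_mod_cast h)] at hd
        exact Nat.not_even_iff_odd.2 hnodd (even_iff_two_dvd.2 hd)
      have hl' := Nat.prime_iff_prime_int.1 hl
      have h1 : (l : ℤ) ∣ z - b := hn ▸ Int.natCast_dvd_natCast.2 hd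
      obtain ⟨hz, hb⟩ := hl'.dvd_of_dvd_sub_of_dvd_add hl2 h1 ((hl'.dvd_or_dvd hW).resolve_left hl2)
      exact hcop l hl hs hb ht hz
  have h1 := jacobiSym_seventeen_natAbs (z - b) hodd
  rw [hn, Int.natAbs_natCast] at h1
  rw [jacobiSym.neg _ hnodd, h1] at key
  rw [hn]; exact_mod_cast key

theorem jacobiSym_sub_eq_one {c d x z : ℤ} (h : c ^ 2 + 2 * d ^ 2 = 2 * z ^ 2 + 17 * x ^ 2)
    (h17 : ¬17 ∣ z - d)
    (hcop : ∀ l : ℕ, l.Prime → (l : ℤ) ∣ c → (l : ℤ) ∣ d → (l : ℤ) ∣ x → (l : ℤ) ∣ z → False) :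
    J(z - d | 17) = 1 := by
  obtain ⟨k, m, hm, hk⟩ := Nat.exists_eq_two_pow_mul_odd (n := (z - d).natAbs)
    (by rw [Int.natAbs_ne_zero]; intro h; simp [h] at h17)
  obtain ⟨τ, hτu, hτ, hzd⟩ : ∃ τ : ℤ, IsUnit τ ∧ J(τ | 17) = 1 ∧ z - d = τ * (2 ^ k * m) := by
    have e : ((z - d).natAbs : ℤ) = 2 ^ k * m := by rw [hk]; push_cast; rfl
    rcases Int.natAbs_eq (z - d) with h | h
    · exact ⟨1, isUnit_one, by norm_num, by rw [← e]; linarith⟩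
    · exact ⟨-1, isUnit_one.neg, by norm_num, by rw [← e]; linarith⟩
  have key : J(17 | m) = 1 := by
    refine jacobiSym_eq_one_of_mul_eq_norm (W := τ * 2 ^ k * (2 * (z + d))) (s := c) (t := x)
      (by rintro rfl; simp at hm) (fun l hl hd h => ?_) ?_ (fun l hl hd hW hs ht => ?_)
    · have h' : l ∣ 17 := Int.natCast_dvd_natCast.1 (by simpa using h)
      rw [(Nat.prime_dvd_prime_iff_eq hl (by norm_num)).1 h'] at hd
      exact h17 (hzd ▸ ((Int.natCast_dvd_natCast.2 hd).mul_left _).mul_left _)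
    · linear_combination (-2 * (z + d)) * hzd - h
    · have hl2 : ¬(l : ℤ) ∣ 2 := fun h => by
        rw [(Nat.prime_dvd_prime_iff_eq hl Nat.prime_two).1 (by exact_mod_cast h)] at hd
        exact Nat.not_even_iff_odd.2 hm (even_iff_two_dvd.2 hd)
      have hl' := Nat.prime_iff_prime_int.1 hl
      have h1 : (l : ℤ) ∣ z - d :=
        hzd ▸ ((Int.natCast_dvd_natCast.2 hd).mul_left _).mul_left _
      have h2 := (hl'.dvd_or_dvd ((hl'.dvd_or_dvd hW).resolve_left fun h =>
        (hl'.dvd_or_dvd h).elim (fun h => hl'.not_isUnit (isUnit_of_dvd_unit h hτu))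
          fun h => hl2 (hl'.dvd_of_dvd_pow h))).resolve_left hl2
      obtain ⟨hz, hd⟩ := hl'.dvd_of_dvd_sub_of_dvd_add hl2 h1 h2
      exact hcop l hl hs hd ht hz
  rw [hzd, jacobiSym.mul_left, jacobiSym.mul_left, jacobiSym.pow_left, hτ,
    show J(2 | 17) = 1 by norm_num, one_pow, one_mul, one_mul]
  have h1 := jacobiSym_seventeen_natAbs m (by exact_mod_cast hm)
  rw [Int.natAbs_natCast] at h1
  rw [← h1, key]

section Core

variable {x y z a b c d : ℤ}

theorem parity_of_norm_eq (h1 : a ^ 2 + 2 * b ^ 2 = 2 * z ^ 2 - 17 * x ^ 2)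
    (h2 : c ^ 2 + 2 * d ^ 2 = 2 * z ^ 2 + 17 * x ^ 2) (hx : Odd x) (hz : Odd z) :
    Odd a ∧ Even b ∧ Odd c ∧ Odd d := by
  obtain ⟨u, hu⟩ := Int.eight_dvd_sq_sub_one_of_odd hx
  obtain ⟨v, hv⟩ := Int.eight_dvd_sq_sub_one_of_odd hz
  have ha : Odd a := by
    have : Odd (a ^ 2) := ⟨z ^ 2 - b ^ 2 - 9 - 68 * u, by linear_combination h1 - 17 * hu⟩
    exact (Int.odd_pow' two_ne_zero).1 this
  have hc : Odd c := by
    have : Odd (c ^ 2) := ⟨z ^ 2 - d ^ 2 + 8 + 68 * u, by linear_combination h2 + 17 * hu⟩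
    exact (Int.odd_pow' two_ne_zero).1 this
  obtain ⟨s, hs⟩ := Int.eight_dvd_sq_sub_one_of_odd ha
  obtain ⟨t, ht⟩ := Int.eight_dvd_sq_sub_one_of_odd hc
  refine ⟨ha, ?_, hc, ?_⟩
  · have : Even (b ^ 2) := ⟨4 * v - 34 * u - 2 * s - 4, by linarith⟩
    exact (Int.even_pow.1 this).1
  · have : Odd (d ^ 2) := ⟨4 * v + 34 * u - 2 * t + 4, by linarith⟩
    exact (Int.odd_pow' two_ne_zero).1 this

theorem emod_eight_of_norm_eq (hb : Even b) (ha : Odd a) (hd : Odd d) (hy : Odd y)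
    (h3 : 3 * (a * c - 2 * b * d) - 4 * (a * d + b * c) = y ^ 2) (hzb : (z - b) % 4 = 3) :
    ((2 * z - a : ℤ) : ZMod 8) = (-(3 * c - 4 * d) : ℤ) - 2 := by
  obtain ⟨s, hs⟩ := Int.eight_dvd_sq_sub_one_of_odd ha
  obtain ⟨t, ht⟩ := Int.eight_dvd_sq_sub_one_of_odd hy
  obtain ⟨β, hb⟩ := hb
  obtain ⟨α, ha⟩ := ha
  obtain ⟨δ, hd⟩ := hd
  obtain ⟨m, hm⟩ : ∃ m, z = b + 3 + 4 * m := ⟨(z - b) / 4, by omega⟩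
  have h : ∀ A B : ℤ, 8 ∣ A - (B - 2) → (A : ZMod 8) = (B : ZMod 8) - 2 := by
    intro A B h
    exact_mod_cast ((ZMod.intCast_eq_intCast_iff_dvd_sub (B - 2) A 8).2 h).symm
  apply h
  refine ⟨β * (2 + 6 * α * δ + 3 * α + 3 * δ + a * c) + a * t - s * (3 * c - 4 * d) + 1 + m, ?_⟩
  have e : 1 + 3 * a * d = 2 * (2 + 6 * α * δ + 3 * α + 3 * δ) := by rw [ha, hd]; ring
  linear_combination (-(3 * c - 4 * d)) * hs + a * h3 + a * ht + 2 * hm + 4 * β * e +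
    (2 + 6 * a * d + 4 * a * c) * hb

theorem false_of_norm_eq (h1 : a ^ 2 + 2 * b ^ 2 = 2 * z ^ 2 - 17 * x ^ 2)
    (h2 : c ^ 2 + 2 * d ^ 2 = 2 * z ^ 2 + 17 * x ^ 2)
    (h3 : 3 * (a * c - 2 * b * d) - 4 * (a * d + b * c) = y ^ 2)
    (hcop : ∃ i j k, i * x + j * y + k * z = 1) (hx : Odd x) (hy : Odd y) (hz : Odd z)
    (hz0 : 0 < z) (hy17 : ¬17 ∣ y) : False := by
  obtain ⟨ha, hb, hc, hd⟩ := parity_of_norm_eq h1 h2 hx hz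
  have hcopR : ∀ (R : Type) [CommRing R] (ϖ : R), Prime ϖ → ϖ ∣ x → ϖ ∣ y → ϖ ∣ z → False := by
    intro R _ ϖ hϖ hx hy hz
    obtain ⟨i, j, k, h⟩ := hcop
    have h' := congrArg (Int.cast : ℤ → R) h
    push_cast at h'
    exact hϖ.not_isUnit (isUnit_of_dvd_one
      (h' ▸ ((hx.mul_left _).add (hy.mul_left _)).add (hz.mul_left _)))
  have hcopZ : ∀ l : ℕ, l.Prime → (l : ℤ) ∣ y ^ 2 → (l : ℤ) ∣ x → (l : ℤ) ∣ z → False := by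
    intro l hl hy hx hz
    have hl' := Nat.prime_iff_prime_int.1 hl
    exact hcopR ℤ l hl' hx (hl'.dvd_of_dvd_pow hy) hz
  have hcop1 : ∀ l : ℕ, l.Prime → (l : ℤ) ∣ a → (l : ℤ) ∣ b → (l : ℤ) ∣ x → (l : ℤ) ∣ z →
      False := fun l hl h h' => hcopZ l hl <| by
    rw [← h3, show 3 * (a * c - 2 * b * d) - 4 * (a * d + b * c) =
      a * (3 * c - 4 * d) - b * (6 * d + 4 * c) by ring]
    exact (h.mul_right _).sub (h'.mul_right _)
  have hcop2 : ∀ l : ℕ, l.Prime → (l : ℤ) ∣ c → (l : ℤ) ∣ d → (l : ℤ) ∣ x → (l : ℤ) ∣ z →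
      False := fun l hl h h' => hcopZ l hl <| by
    rw [← h3, show 3 * (a * c - 2 * b * d) - 4 * (a * d + b * c) =
      c * (3 * a - 4 * b) - d * (6 * b + 4 * a) by ring]
    exact (h.mul_right _).sub (h'.mul_right _)
  have hχ6 : J(6 | 17) = -1 := by norm_num
  have hχ2 : J(2 | 17) = 1 := by norm_num
  have hacbd : J(a - 7 * b | 17) * J(c - 7 * d | 17) = -1 := by
    have : J(6 * ((a - 7 * b) * (c - 7 * d)) | 17) = J(2 * y ^ 2 | 17) :=
      jacobiSym_eq_of_dvd_sub ⟨-2 * a * d - 2 * b * c + 18 * b * d, by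
        push_cast; rw [← h3]; ring⟩
    rw [jacobiSym.mul_left, jacobiSym.mul_left, jacobiSym.mul_left, jacobiSym.pow_left,
      jacobiSym_seventeen_sq hy17, hχ6, hχ2] at this
    linarith
  have hab17 : ¬17 ∣ a - 7 * b := fun h => by
    rw [jacobiSym_seventeen_eq_zero_iff.2 h] at hacbd; simp at hacbd
  have hcd17 : ¬17 ∣ c - 7 * d := fun h => by
    rw [jacobiSym_seventeen_eq_zero_iff.2 h] at hacbd; simp at hacbd
  have hχcd : J(c - 7 * d | 17) = -1 := by
    obtain ⟨d', hd', hzd, e⟩ := exists_jacobiSym_seventeen_eq_neg (a := c) (b := d) (z := z)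
      ⟨x ^ 2, by linear_combination h2⟩ hcd17
    have := jacobiSym_sub_eq_one (c := c) (d := d') (x := x) (z := z)
      (by rcases hd' with rfl | rfl <;> linarith) hzd
      (by rcases hd' with rfl | rfl <;> simpa using hcop2)
    linarith
  have hzb : (z - b) % 4 = 3 := by
    obtain ⟨b', hb', hzb, e⟩ := exists_jacobiSym_seventeen_eq_neg (a := a) (b := b) (z := z)
      ⟨-x ^ 2, by linear_combination h1⟩ hab17
    have hodd : Odd (z - b') := by
      rcases hb' with rfl | rfl
      · exact hz.sub_even hb
      · exact hz.sub_even hb.neg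
    have := χ₄_mul_jacobiSym_sub_eq_one (a := a) (b := b') (x := x) (z := z)
      (by rcases hb' with rfl | rfl <;> linarith) hz0 (by rintro rfl; simp at hx) hodd hzb
      (by rcases hb' with rfl | rfl <;> simpa using hcop1)
    have h4 : (z - b') % 4 = 3 := by
      rcases (by have := Int.odd_iff.1 hodd; omega : (z - b') % 4 = 1 ∨ (z - b') % 4 = 3) with h | h
      · rw [ZMod.χ₄_int_one_mod_four h] at this
        rw [hχcd] at hacbd
        linarith
      · exact h
    have := Int.even_iff.1 hb
    rcases hb' with rfl | rfl <;> omega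
  have he : J(3 * c - 4 * d | 17) = 1 := by
    have : J(2 * (3 * c - 4 * d) | 17) = J(6 * (c - 7 * d) | 17) :=
      jacobiSym_eq_of_dvd_sub ⟨2 * d, by push_cast; ring⟩
    rwa [jacobiSym.mul_left, jacobiSym.mul_left, hχ6, hχ2, hχcd, one_mul] at this
  have hQ := emod_eight_of_norm_eq hb ha hd hy h3 hzb
  have hPodd : Odd (-(3 * c - 4 * d)) := by
    rw [Int.odd_iff] at hc ⊢; omega
  have hfinal := jacobiSym_seventeen_of_norm_sqrt (P := -(3 * c - 4 * d)) (Q := 2 * z - a)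
    (P' := 3 * c - 4 * d) (Q' := 2 * z + a) (b := b) (f := -(3 * d + 2 * c)) (y := y)
    (by linear_combination (-17 : ℤ) * h1 - 17 * h2) (by linear_combination (-2 : ℤ) * h3) ?_ ?_ ?_ ?_
  · rw [χ₈_mul_χ₄_eq_one hPodd hQ, jacobiSym_seventeen_neg, he] at hfinal
    norm_num at hfinal
  · intro R _ _ ϖ r hϖ hr hϖ2 hϖ17 hT hT' hf hy
    push_cast at hT hT' hf
    have hrϖ : ¬ϖ ∣ r := fun h => hϖ17 (hr ▸ dvd_pow h two_ne_zero)
    have hz : ϖ ∣ z := by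
      have : ϖ ∣ 2 * (2 * (r * z)) := by
        have := hT.add hT'
        ring_nf at this ⊢
        exact this
      exact ((hϖ.dvd_or_dvd (((hϖ.dvd_or_dvd ((hϖ.dvd_or_dvd this).resolve_left hϖ2)).resolve_left
        hϖ2))).resolve_left hrϖ)
    have he : ϖ ∣ 3 * c - 4 * d + a * r := by
      have : ϖ ∣ 2 * (3 * c - 4 * d + a * r) := by
        have := hT'.sub hT
        ring_nf at this ⊢
        exact this
      exact (hϖ.dvd_or_dvd this).resolve_left hϖ2
    have hx : ϖ ∣ 17 * (2 * (17 * x ^ 2)) := by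
      have e : (17 : R) * (2 * (17 * x ^ 2)) = (3 * c - 4 * d + a * r) * (3 * c - 4 * d - a * r) +
          (-(3 * d + 2 * c) + b * r) * (2 * (-(3 * d + 2 * c) - b * r)) := by
        have h1' := congrArg (Int.cast : ℤ → R) h1
        have h2' := congrArg (Int.cast : ℤ → R) h2
        push_cast at h1' h2'
        linear_combination 17 * h1' - 17 * h2' + (a ^ 2 + 2 * b ^ 2) * hr
      rw [e]
      exact (he.mul_right _).add (hf.mul_right _)
    exact hcopR R ϖ hϖ (hϖ.dvd_of_dvd_pow ((hϖ.dvd_or_dvd ((hϖ.dvd_or_dvd ((hϖ.dvd_or_dvd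
      hx).resolve_left hϖ17)).resolve_left hϖ2)).resolve_left hϖ17)) hy hz
  · rw [← jacobiSym_seventeen_eq_zero_iff, jacobiSym_seventeen_neg, he]; norm_num
  · have := (ZMod.intCast_eq_intCast_iff_dvd_sub (2 * z - a) (-(3 * c - 4 * d) - 2) 8).1
      (by rw [hQ]; push_cast; ring)
    obtain ⟨m, hm⟩ := this
    have e : 2 * z - a = -(3 * c - 4 * d) - 2 - 8 * m := by push_cast at hm; linarith
    obtain ⟨n, hn⟩ := Int.eight_dvd_sq_sub_one_of_odd hPodd
    obtain ⟨k, hk⟩ := hPodd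
    have : -(3 * c - 4 * d) * (2 * z - a) = 4 * (2 * n - k - 2 * m * -(3 * c - 4 * d) - 1) + 3 := by
      rw [e]; linear_combination hn - 2 * hk
    omega
  · have h17 : √17 ^ 2 = (17 : ℝ) := Real.sq_sqrt (by norm_num)
    have h0 : 0 < √(17 : ℝ) := by positivity
    have hy0 : (0 : ℝ) < y ^ 2 := by
      have : (y : ℝ) ≠ 0 := by rintro h; rw [Int.cast_eq_zero] at h; simp [h] at hy17
      positivity
    have hz0' : (0 : ℝ) < z := by exact_mod_cast hz0
    push_cast
    have h1' := congrArg (Int.cast : ℤ → ℝ) h1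
    have h2' := congrArg (Int.cast : ℤ → ℝ) h2
    have h3' := congrArg (Int.cast : ℤ → ℝ) h3
    push_cast at h1' h2' h3'
    set T : ℝ := -(3 * c - 4 * d) - √17 * (2 * z - a) with hT
    set T' : ℝ := 3 * c - 4 * d - √17 * (2 * z + a) with hT'
    have hsum : T + T' < 0 := by
      have : T + T' = -(4 * (√17 * z)) := by rw [hT, hT']; ring
      have := mul_pos h0 hz0'
      linarith
    have hprod : 0 < T * T' := by
      have : T * T' = 2 * (-(3 * d + 2 * c) - √17 * b) ^ 2 + 2 * (√17 * y ^ 2) := by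
        rw [hT, hT']
        linear_combination (-17 : ℝ) * h1' - 17 * h2' + 2 * √17 * h3' +
          (4 * z ^ 2 - a ^ 2 - 2 * b ^ 2 : ℝ) * h17
      rw [this]; positivity
    have : T < 0 := by
      by_contra! h
      nlinarith
    linarith

end Core

theorem Int.exists_eq_mul_of_ne_zero {X Y Z : ℤ} (h : (X, Y, Z) ≠ (0, 0, 0)) :
    ∃ g x y z i j k : ℤ, g ≠ 0 ∧ X = g * x ∧ Y = g * y ∧ Z = g * z ∧
      i * x + j * y + k * z = 1 := by
  obtain ⟨g, hg⟩ := IsPrincipalIdealRing.principal (Ideal.span {X, Y, Z})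
  have hmem : ∀ n, n ∈ Ideal.span {X, Y, Z} ↔ g ∣ n := fun n => by
    rw [hg]; exact Ideal.mem_span_singleton
  obtain ⟨x, rfl⟩ := (hmem X).1 (Ideal.subset_span (by simp))
  obtain ⟨y, rfl⟩ := (hmem Y).1 (Ideal.subset_span (by simp))
  obtain ⟨z, rfl⟩ := (hmem Z).1 (Ideal.subset_span (by simp))
  obtain ⟨i, j, k, hijk⟩ := Submodule.mem_span_triple.1 ((hmem g).2 dvd_rfl)
  have hg0 : g ≠ 0 := by rintro rfl; simp at h
  refine ⟨g, x, y, z, i, j, k, hg0, rfl, rfl, rfl, mul_left_cancel₀ hg0 ?_⟩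
  simp only [smul_eq_mul] at hijk
  linear_combination hijk

theorem odd_of_eq {x y z u i j k : ℤ}
    (h : y ^ 4 + 2 * u ^ 2 = 17 * ((2 * z ^ 2 - 17 * x ^ 2) * (2 * z ^ 2 + 17 * x ^ 2)))
    (hcop : i * x + j * y + k * z = 1) : Odd x ∧ Odd y ∧ Odd z := by
  have hx : Odd x := by
    rw [← Int.not_even_iff_odd, even_iff_two_dvd]
    rintro ⟨x, rfl⟩
    obtain ⟨y, rfl⟩ : 2 ∣ y := Int.prime_two.dvd_of_dvd_pow (n := 4)
      ⟨-u ^ 2 + 34 * z ^ 4 - 17 ^ 3 * 8 * x ^ 4, by linear_combination h⟩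
    obtain ⟨u, rfl⟩ : 2 ∣ u := Int.prime_two.dvd_of_dvd_pow (n := 2)
      ⟨-4 * y ^ 4 + 17 * z ^ 4 - 17 ^ 3 * 4 * x ^ 4, by linarith⟩
    obtain ⟨z, rfl⟩ : 2 ∣ z := Int.prime_two.dvd_of_dvd_pow (n := 4)
      ⟨2 * y ^ 4 + u ^ 2 + 17 ^ 3 * 2 * x ^ 4 - 8 * z ^ 4, by linarith⟩
    have : (2 : ℤ) ∣ 1 := ⟨i * x + j * y + k * z, by linear_combination -hcop⟩
    norm_num at this
  obtain ⟨m, hm⟩ := Int.eight_dvd_sq_sub_one_of_odd hx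
  have hx4 : x ^ 4 = 1 + 16 * (m + 4 * m ^ 2) := by linear_combination (x ^ 2 + 1 + 8 * m) * hm
  have hy : Odd y := by
    have : Odd (y ^ 4) := ⟨-u ^ 2 + 34 * z ^ 4 - 17 ^ 3 * 8 * (m + 4 * m ^ 2) - 2457, by
      linear_combination h - 17 ^ 3 * hx4⟩
    exact (Int.odd_pow' four_ne_zero).1 this
  refine ⟨hx, hy, ?_⟩
  obtain ⟨n, hn⟩ := Int.eight_dvd_sq_sub_one_of_odd hy
  have hy4 : y ^ 4 = 1 + 16 * (n + 4 * n ^ 2) := by linear_combination (y ^ 2 + 1 + 8 * n) * hn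
  rw [← Int.not_even_iff_odd, even_iff_two_dvd]
  rintro ⟨z, rfl⟩
  have hu : u ^ 2 = 8 * (-(n + 4 * n ^ 2) + 68 * z ^ 4 - 17 ^ 3 * (m + 4 * m ^ 2) - 308) + 7 := by
    linarith
  have key : ∀ a : ZMod 8, a ^ 2 ≠ 7 := by decide
  apply key u
  have := congrArg (Int.cast : ℤ → ZMod 8) hu
  push_cast at this
  rw [this, show (8 : ZMod 8) = 0 by decide, zero_mul, zero_add]

theorem not_seventeen_dvd_of_eq {x y z u i j k : ℤ}
    (h : y ^ 4 + 2 * u ^ 2 = 17 * ((2 * z ^ 2 - 17 * x ^ 2) * (2 * z ^ 2 + 17 * x ^ 2)))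
    (hcop : i * x + j * y + k * z = 1) : ¬17 ∣ y := by
  have hp := Int.prime_seventeen
  have h2 : ¬(17 : ℤ) ∣ 2 := by norm_num
  rintro ⟨y, rfl⟩
  obtain ⟨u, rfl⟩ : 17 ∣ u := hp.dvd_of_dvd_pow (n := 2) <| (hp.dvd_or_dvd
    ⟨4 * z ^ 4 - 289 * x ^ 4 - 17 ^ 3 * y ^ 4, by linear_combination h⟩).resolve_left h2
  obtain ⟨z, rfl⟩ : 17 ∣ z := hp.dvd_of_dvd_pow (n := 4) <| (hp.dvd_or_dvd
    (a := 4) ⟨17 ^ 2 * y ^ 4 + 2 * u ^ 2 + 17 * x ^ 4, by linarith⟩).resolve_left (by norm_num)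
  obtain ⟨u, rfl⟩ : 17 ∣ u := hp.dvd_of_dvd_pow (n := 2) <| (hp.dvd_or_dvd
    ⟨4 * 17 ^ 2 * z ^ 4 - x ^ 4 - 17 * y ^ 4, by linarith⟩).resolve_left h2
  obtain ⟨x, rfl⟩ : 17 ∣ x := hp.dvd_of_dvd_pow (n := 4)
    ⟨4 * 17 * z ^ 4 - y ^ 4 - 2 * u ^ 2, by linarith⟩
  have : (17 : ℤ) ∣ 1 := ⟨i * x + j * y + k * z, by linear_combination -hcop⟩
  norm_num at this

theorem false_of_eq {x y z u i j k : ℤ}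
    (h : y ^ 4 + 2 * u ^ 2 = 17 * ((2 * z ^ 2 - 17 * x ^ 2) * (2 * z ^ 2 + 17 * x ^ 2)))
    (hcop : i * x + j * y + k * z = 1) : False := by
  obtain ⟨hx, hy, hz⟩ := odd_of_eq h hcop
  have hy17 := not_seventeen_dvd_of_eq h hcop
  wlog hz0 : 0 < z generalizing z k
  · have hz0' : z ≠ 0 := by rintro rfl; simp at hz
    exact this (z := -z) (k := -k) (by rw [neg_sq]; exact h) (by linarith) hz.neg (by omega)
  wlog hu : 17 ∣ y ^ 2 + 7 * u generalizing u
  · refine this (u := -u) (by rw [neg_sq]; exact h) ?_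
    have : 17 ∣ (y ^ 2 + 7 * u) * (y ^ 2 + 7 * -u) :=
      ⟨(2 * z ^ 2 - 17 * x ^ 2) * (2 * z ^ 2 + 17 * x ^ 2) - 3 * u ^ 2, by linear_combination h⟩
    exact (Int.prime_seventeen.dvd_or_dvd this).resolve_left hu
  obtain ⟨m, hm⟩ := hu
  have hst : (3 * m - u) ^ 2 + 2 * (u - 2 * m) ^ 2 =
      (2 * z ^ 2 - 17 * x ^ 2) * (2 * z ^ 2 + 17 * x ^ 2) := by
    have e : y ^ 2 = 17 * m - 7 * u := by linarith
    have : 17 * ((3 * m - u) ^ 2 + 2 * (u - 2 * m) ^ 2) =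
      17 * ((2 * z ^ 2 - 17 * x ^ 2) * (2 * z ^ 2 + 17 * x ^ 2)) := by
      rw [← h]; linear_combination (-(y ^ 2 + 17 * m - 7 * u)) * e
    linarith
  have hy2 : y ^ 2 = 3 * (3 * m - u) - 4 * (u - 2 * m) := by linarith
  have hG : 0 < 2 * z ^ 2 + 17 * x ^ 2 := by positivity
  have hF : 0 ≤ 2 * z ^ 2 - 17 * x ^ 2 := nonneg_of_mul_nonneg_left (hst ▸ by positivity) hG
  obtain ⟨a, b, c, d, h1, h2, hs, ht⟩ := exists_factorization (4 * z ^ 2).toNat hF hG.le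
    (by rw [Int.toNat_of_nonneg (by positivity)]; linarith) hst (fun p hpF hpG hps hpt => by
    by_contra hpu
    obtain ⟨l, hl, hlp⟩ := Int.exists_prime_and_dvd (n := p)
      fun h => hpu (Int.isUnit_iff_natAbs_eq.2 h)
    have hly : l ∣ y := hl.dvd_of_dvd_pow (n := 2) <| by
      rw [hy2]
      exact ((hlp.trans hps).mul_left _).sub ((hlp.trans hpt).mul_left _)
    have hl2 : ¬l ∣ 2 := fun h => by
      have : l ∣ 1 := by
        obtain ⟨n, hn⟩ := hy
        have := hly.sub (h.mul_right n)
        rwa [hn, add_sub_cancel_left] at this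
      exact hl.not_isUnit (isUnit_of_dvd_one this)
    have hl17 : ¬l ∣ 17 := fun h => hy17 <|
      (hl.associated_of_dvd Int.prime_seventeen h).symm.dvd.trans hly
    have hlz : l ∣ z := hl.dvd_of_dvd_pow (n := 2) <| by
      have : l ∣ 2 * (2 * z ^ 2) := by
        have := (hlp.trans hpF).add (hlp.trans hpG)
        ring_nf at this ⊢
        exact this
      exact (hl.dvd_or_dvd ((hl.dvd_or_dvd this).resolve_left hl2)).resolve_left hl2
    have hlx : l ∣ x := hl.dvd_of_dvd_pow (n := 2) <| by
      have : l ∣ 2 * (17 * x ^ 2) := by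
        have := (hlp.trans hpG).sub (hlp.trans hpF)
        ring_nf at this ⊢
        exact this
      exact (hl.dvd_or_dvd ((hl.dvd_or_dvd this).resolve_left hl2)).resolve_left hl17
    exact hl.not_isUnit (isUnit_of_dvd_one
      (hcop ▸ ((hlx.mul_left _).add (hly.mul_left _)).add (hlz.mul_left _))))
  exact false_of_norm_eq h1 h2 (by rw [hs, ht, hy2]) ⟨i, j, k, hcop⟩ hx hy hz hz0 hy17

/-- The equation `w² = -9826·x⁴ + -2·y⁴ + 136·z⁴` has no rational solution with
`(x, y, z) ≠ (0, 0, 0)`. -/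
theorem no_rational_points_case_15 :
    ¬ ∃ w x y z : ℚ, w ^ 2 = (-9826) * x ^ 4 + (-2) * y ^ 4 + (136) * z ^ 4 ∧
      (x, y, z) ≠ (0, 0, 0) := by
  rintro ⟨w, x, y, z, h, h0⟩
  obtain ⟨D, hD, W, X, Y, Z, hW, hX, hY, hZ⟩ : ∃ D : ℤ, D ≠ 0 ∧ ∃ W X Y Z : ℤ,
      (W : ℚ) = w * D ^ 2 ∧ (X : ℚ) = x * D ∧ (Y : ℚ) = y * D ∧ (Z : ℚ) = z * D := by
    refine ⟨w.den * x.den * y.den * z.den, ?_,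
      w.num * w.den * (x.den * y.den * z.den) ^ 2, x.num * (w.den * y.den * z.den),
      y.num * (w.den * x.den * z.den), z.num * (w.den * x.den * y.den), ?_, ?_, ?_, ?_⟩
    · have := w.den_nz; have := x.den_nz; have := y.den_nz; have := z.den_nz
      positivity
    · push_cast; rw [← Rat.mul_den_eq_num w]; ring
    · push_cast; rw [← Rat.mul_den_eq_num x]; ring
    · push_cast; rw [← Rat.mul_den_eq_num y]; ring
    · push_cast; rw [← Rat.mul_den_eq_num z]; ring
  have hD' : (D : ℚ) ≠ 0 := by exact_mod_cast hD
  have hWXYZ : W ^ 2 = -9826 * X ^ 4 + -2 * Y ^ 4 + 136 * Z ^ 4 := by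
    have : (W : ℚ) ^ 2 = -9826 * X ^ 4 + -2 * Y ^ 4 + 136 * Z ^ 4 := by
      rw [hW, hX, hY, hZ]; linear_combination D ^ 4 * h
    exact_mod_cast this
  obtain ⟨g, x', y', z', i, j, k, hg, rfl, rfl, rfl, hcop⟩ :=
    Int.exists_eq_mul_of_ne_zero (X := X) (Y := Y) (Z := Z) (fun e => h0 (by
      simp only [Prod.mk.injEq] at e ⊢
      obtain ⟨rfl, rfl, rfl⟩ := e
      simpa [hD'] using And.intro hX.symm (And.intro hY.symm hZ.symm)))
  obtain ⟨v, rfl⟩ : g ^ 2 ∣ W := (Int.pow_dvd_pow_iff two_ne_zero).1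
    ⟨-9826 * x' ^ 4 + -2 * y' ^ 4 + 136 * z' ^ 4, by rw [hWXYZ]; ring⟩
  have hv : v ^ 2 = -9826 * x' ^ 4 + -2 * y' ^ 4 + 136 * z' ^ 4 :=
    mul_left_cancel₀ (pow_ne_zero 4 hg) (by linear_combination hWXYZ)
  obtain ⟨u, rfl⟩ : 2 ∣ v := Int.prime_two.dvd_of_dvd_pow (n := 2)
    ⟨-4913 * x' ^ 4 - y' ^ 4 + 68 * z' ^ 4, by rw [hv]; ring⟩
  exact false_of_eq (u := u) (by linarith) hcop
end
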